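/- Main coercive inequality (Theorem 1, first part). There exists a constant C > 0, depending only on n, s, γ, C_Φ, c_b, R and δ, such that the following holds. For every kernel b satisfying the standing kernel assumptions, every nonnegative measurable g : ℝⁿ → [0,∞) that is integrable on B_R and satisfies Assumption L with constants R > δ > 0 and C̃_g > 0, and every measurable f : ℝⁿ → ℝ, one has the inequality (∫_{B_R} g) · N_g(f) ≥ C · C̃_g² · |f|²_{Ṅ^{s,γ}}, as an inequality of values in [0,∞]. -/

import Mathlib

open MeasureTheory Real Set Metric
open scoped ENNReal RealInnerProductSpace

noncomputable section

/-- `ℝⁿ` with the Euclidean structure. -/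
abbrev V (n : ℕ) := EuclideanSpace ℝ (Fin n)

/-- the Japanese bracket `⟨v⟩ = √(1+|v|²)`. -/
def jap {n : ℕ} (v : V n) : ℝ := Real.sqrt (1 + ‖v‖ ^ 2)

/-- the post-collisional velocity `v' = (v+v_*)/2 + (|v-v_*|/2)σ`. -/
def vprime {n : ℕ} (v vs σ : V n) : V n :=
  (2:ℝ)⁻¹ • (v + vs) + (‖v - vs‖ / 2) • σ

/-- the anisotropic metric `d(v,v') = √(|v-v'|² + ¼(|v|²-|v'|²)²)` on the lifted paraboloid. -/
def anisoDist {n : ℕ} (v v' : V n) : ℝ :=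
  Real.sqrt (‖v - v'‖ ^ 2 + 4⁻¹ * (‖v‖ ^ 2 - ‖v'‖ ^ 2) ^ 2)

/-- The standing assumptions on the angular kernel `b`: measurability, nonnegativity,
vanishing for deviation angles `θ ∈ (π/2, π]`, and the two-sided power bound
`c_b θ^{-(1+2s)} ≤ sin^{n-2}θ · b(cos θ) ≤ c_b⁻¹ θ^{-(1+2s)}` on `(0, π/2]`. -/
def KernelAssumptions (n : ℕ) (s cb : ℝ) (b : ℝ → ℝ) : Prop :=
  Measurable b ∧ (∀ t : ℝ, 0 ≤ b t) ∧
  (∀ θ : ℝ, θ ∈ Set.Ioc (π / 2) π → b (Real.cos θ) = 0) ∧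
  (∀ θ : ℝ, θ ∈ Set.Ioc 0 (π / 2) →
    cb * θ ^ (-(1 + 2 * s)) ≤ Real.sin θ ^ ((n : ℝ) - 2) * b (Real.cos θ) ∧
    Real.sin θ ^ ((n : ℝ) - 2) * b (Real.cos θ) ≤ cb⁻¹ * θ ^ (-(1 + 2 * s)))

/-- The Boltzmann collision kernel `B(v-v_*,σ) = C_Φ |v-v_*|^γ b(⟨(v-v_*)/|v-v_*|, σ⟩)`. -/
def Bker {n : ℕ} (CΦ γ : ℝ) (b : ℝ → ℝ) (v vs σ : V n) : ℝ :=
  CΦ * ‖v - vs‖ ^ γ * b ⟪‖v - vs‖⁻¹ • (v - vs), σ⟫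

/-- the surface measure on the unit sphere `S^{n-1}`. -/
def sphMeas (n : ℕ) : Measure (Metric.sphere (0 : V n) 1) :=
  (volume : Measure (V n)).toSphere

/-- the anisotropic seminorm `|f|²_{Ṅ^{s,γ}}`, as a value in `[0,∞]`. -/
def NdotSq {n : ℕ} (s γ : ℝ) (f : V n → ℝ) : ℝ≥0∞ :=
  ∫⁻ v : V n, ∫⁻ v' : V n, (if anisoDist v v' ≤ 1 then
    ENNReal.ofReal ((jap v * jap v') ^ ((γ + 2 * s + 1) / 2) * (f v' - f v) ^ 2 *
      anisoDist v v' ^ (-((n : ℝ) + 2 * s))) else 0)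

/-- `T` is a tube of radius `δ` around some affine line of `ℝⁿ`. -/
def IsTube {n : ℕ} (δ : ℝ) (T : Set (V n)) : Prop :=
  ∃ p u : V n, u ≠ 0 ∧ T = {x | Metric.infDist x {y | ∃ t : ℝ, y = p + t • u} ≤ δ}

/-- Assumption L: `∫_{B_R ∖ T} g ≥ C̃_g` for every tube `T` of radius `δ`. -/
def AssumptionL {n : ℕ} (R δ Cg : ℝ) (g : V n → ℝ) : Prop :=
  ∀ T : Set (V n), IsTube δ T →
    ENNReal.ofReal Cg ≤ ∫⁻ x in Metric.closedBall (0 : V n) R \ T, ENNReal.ofReal (g x)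

/-- `N_g(f)`: the diffusive part of the collision operator, as a value in `[0,∞]`. -/
def Ng {n : ℕ} (CΦ γ : ℝ) (b : ℝ → ℝ) (g f : V n → ℝ) : ℝ≥0∞ :=
  2⁻¹ * ∫⁻ v : V n, ∫⁻ vs : V n, ∫⁻ σ : Metric.sphere (0 : V n) 1,
    ENNReal.ofReal (Bker CΦ γ b v vs σ * g vs * (f (vprime v vs σ) - f v) ^ 2)
      ∂(sphMeas n)

noncomputable section

/-- Expanding maps do not decrease volume (set version). -/
lemma vol_expand {n : ℕ} (X B : Set (V n)) (Ψ : V n → V n) (C : ℝ) (hC : 0 ≤ C)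
    (hmap : ∀ x ∈ X, Ψ x ∈ B)
    (hexp : ∀ x ∈ X, ∀ y ∈ X, ‖x - y‖ ≤ C * ‖Ψ x - Ψ y‖) :
    volume X ≤ ENNReal.ofReal (C ^ n) * volume B := by
  classical
  have hfr : Module.finrank ℝ (V n) = n := by simp
  have hH : (μH[(n:ℝ)] : Measure (V n)).IsAddHaarMeasure := by
    have := isAddHaarMeasure_hausdorffMeasure (E := V n)
    rwa [hfr] at this
  have key : μH[(n:ℝ)] X ≤ ENNReal.ofReal (C ^ n) * μH[(n:ℝ)] B := by
    have hinj : InjOn Ψ X := by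
      intro x hx y hy hxy
      have := hexp x hx y hy
      rw [hxy, sub_self, norm_zero, mul_zero] at this
      exact sub_eq_zero.1 (norm_le_zero_iff.1 this)
    have hL : LipschitzOnWith C.toNNReal (Function.invFunOn Ψ X) (Ψ '' X) := by
      apply LipschitzOnWith.of_dist_le_mul
      rintro _ ⟨x, hx, rfl⟩ _ ⟨y, hy, rfl⟩
      rw [hinj.leftInvOn_invFunOn hx, hinj.leftInvOn_invFunOn hy, dist_eq_norm, dist_eq_norm,
        Real.coe_toNNReal _ hC]
      exact hexp x hx y hy
    have h1 := hL.hausdorffMeasure_image_le (d := n) (by positivity)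
    rw [hinj.leftInvOn_invFunOn.image_image] at h1
    refine h1.trans ?_
    rw [ENNReal.rpow_natCast, ENNReal.ofReal_pow hC, ENNReal.ofReal]
    gcongr
    rintro _ ⟨x, hx, rfl⟩
    exact hmap x hx
  have hv := Measure.isAddLeftInvariant_eq_smul (volume : Measure (V n)) (μH[(n:ℝ)])
  rw [hv]
  simp only [Measure.smul_apply, ENNReal.smul_def, smul_eq_mul]
  rw [mul_left_comm]
  gcongr

/-- Change of variables inequality for maps expanding relative to a linear map. -/
lemma lintegral_expand {n : ℕ} (D : Set (V n)) (hD : MeasurableSet D) (Ψ : V n → V n)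
    (hΨ : Measurable Ψ) (A : V n →ₗ[ℝ] V n) (hA : A.det ≠ 0) (C : ℝ) (hC : 0 ≤ C)
    (hexp : ∀ x ∈ D, ∀ y ∈ D, ‖A (x - y)‖ ≤ C * ‖Ψ x - Ψ y‖)
    (F : V n → ℝ≥0∞) (hF : Measurable F) :
    ∫⁻ h in D, F (Ψ h) ≤ ENNReal.ofReal (|A.det|⁻¹ * C ^ n) * ∫⁻ y, F y := by
  have hle : Measure.map Ψ (volume.restrict D) ≤
      ENNReal.ofReal (|A.det|⁻¹ * C ^ n) • (volume : Measure (V n)) := by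
    rw [Measure.le_iff]
    intro B hB
    rw [Measure.map_apply hΨ hB, Measure.restrict_apply (hΨ hB), Measure.smul_apply, smul_eq_mul]
    set X := Ψ ⁻¹' B ∩ D
    have h1 : volume X = ENNReal.ofReal |A.det|⁻¹ * volume (A '' X) := by
      rw [Measure.addHaar_image_linearMap, ← mul_assoc, ← ENNReal.ofReal_mul (by positivity),
        inv_mul_cancel₀ (by simpa using hA)]
      simp
    rw [h1, ENNReal.ofReal_mul (by positivity), mul_assoc]
    gcongr
    refine vol_expand (A '' X) B (fun u => Ψ ((A.equivOfDetNeZero hA).symm u)) C hC ?_ ?_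
    · rintro _ ⟨x, hx, rfl⟩
      have : (A.equivOfDetNeZero hA).symm (A x) = x :=
        (A.equivOfDetNeZero hA).symm_apply_apply x
      simp only [this]
      exact hx.1
    · rintro _ ⟨x, hx, rfl⟩ _ ⟨y, hy, rfl⟩
      have h1 : (A.equivOfDetNeZero hA).symm (A x) = x :=
        (A.equivOfDetNeZero hA).symm_apply_apply x
      have h2 : (A.equivOfDetNeZero hA).symm (A y) = y :=
        (A.equivOfDetNeZero hA).symm_apply_apply y
      simp only [h1, h2, ← map_sub]
      exact hexp x hx.2 y hy.2
  rw [← lintegral_map hF hΨ, ← smul_eq_mul, ← lintegral_smul_measure]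
  exact lintegral_mono' hle le_rfl

end

noncomputable section

lemma norm_normalize_sub_le {n : ℕ} (x y : V n) (hx : 1 ≤ ‖x‖) (hy : 0 < ‖y‖) :
    ‖‖x‖⁻¹ • x - ‖y‖⁻¹ • y‖ ≤ 2 * ‖x - y‖ := by
  have e : ‖x‖⁻¹ • x - ‖y‖⁻¹ • y = ‖x‖⁻¹ • ((x - y) + ((‖y‖ - ‖x‖) * ‖y‖⁻¹) • y) := by
    have hx' : ‖x‖ ≠ 0 := by positivity
    have hy' : ‖y‖ ≠ 0 := by positivity
    match_scalars
    · field_simp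
    · field_simp
      ring
  rw [e, norm_smul, norm_inv, norm_norm]
  have h1 : ‖((‖y‖ - ‖x‖) * ‖y‖⁻¹) • y‖ ≤ ‖x - y‖ := by
    rw [norm_smul, norm_mul, norm_inv, norm_norm, mul_assoc, inv_mul_cancel₀ hy.ne', mul_one,
      Real.norm_eq_abs, norm_sub_rev]
    exact abs_norm_sub_norm_le y x
  have h2 : ‖x‖⁻¹ ≤ 1 := inv_le_one_of_one_le₀ hx
  have h3 := norm_add_le (x - y) (((‖y‖ - ‖x‖) * ‖y‖⁻¹) • y)
  calc ‖x‖⁻¹ * ‖(x - y) + ((‖y‖ - ‖x‖) * ‖y‖⁻¹) • y‖ ≤ 1 * (2 * ‖x - y‖) := by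
        gcongr
        linarith
    _ = _ := one_mul _

/-- angle doubling map -/
def dbl {n : ℕ} (u e : V n) : V n := (2 * ⟪u, e⟫) • e - u

lemma norm_dbl {n : ℕ} (u e : V n) (hu : ‖u‖ = 1) (he : ‖e‖ = 1) : ‖dbl u e‖ = 1 := by
  have : ‖dbl u e‖ ^ 2 = 1 := by
    rw [dbl, norm_sub_sq_real, norm_smul, inner_smul_left, hu, he, real_inner_comm u e]
    simp only [Real.norm_eq_abs, mul_one, sq_abs, conj_trivial]
    ring
  have h0 := norm_nonneg (dbl u e)
  nlinarith

/-- angle doubling as a self-map of the sphere -/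
def dblS {n : ℕ} (u e : sphere (0 : V n) 1) : sphere (0 : V n) 1 :=
  ⟨dbl u e, by simpa using norm_dbl (u : V n) e (by simp) (by simp)⟩

lemma dbl_expand {n : ℕ} (u e e' : V n) (hu : ‖u‖ = 1) (he : ‖e‖ = 1) (he' : ‖e'‖ = 1)
    (h1 : 1 / 2 ≤ ⟪u, e⟫) (h2 : 1 / 2 ≤ ⟪u, e'⟫) :
    ‖e - e'‖ ≤ 2 * ‖dbl u e - dbl u e'‖ := by
  set x := (2 * ⟪u, e⟫) • e with hx
  set y := (2 * ⟪u, e'⟫) • e' with hy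
  have hxn : ‖x‖ = 2 * ⟪u, e⟫ := by
    rw [hx, norm_smul, he, mul_one, Real.norm_eq_abs, abs_of_nonneg (by linarith)]
  have hyn : ‖y‖ = 2 * ⟪u, e'⟫ := by
    rw [hy, norm_smul, he', mul_one, Real.norm_eq_abs, abs_of_nonneg (by linarith)]
  have := norm_normalize_sub_le x y (by rw [hxn]; linarith) (by rw [hyn]; linarith)
  rw [hxn, hyn, hx, hy, smul_smul, smul_smul, inv_mul_cancel₀ (by linarith),
    inv_mul_cancel₀ (by linarith), one_smul, one_smul] at this
  simpa [dbl] using this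

lemma measurable_dblS {n : ℕ} (u : sphere (0 : V n) 1) : Measurable (dblS u) := by
  unfold dblS dbl
  apply Measurable.subtype_mk
  fun_prop

instance {n : ℕ} : IsFiniteMeasure (sphMeas n) := by unfold sphMeas; infer_instance

/-- change of variables on the sphere -/
lemma sphere_change {n : ℕ} (u : sphere (0 : V n) 1) (h : sphere (0 : V n) 1 → ℝ≥0∞)
    (hh : Measurable h) :
    ∫⁻ e, (if (1 / 2 : ℝ) ≤ ⟪(u : V n), (e : V n)⟫ then h (dblS u e) else 0) ∂(sphMeas n) ≤
      ENNReal.ofReal (5 ^ n) * ∫⁻ σ, h σ ∂(sphMeas n) := by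
  have hu : ‖(u : V n)‖ = 1 := by simp
  set D : Set (sphere (0 : V n) 1) := {e | (1 / 2 : ℝ) ≤ ⟪(u : V n), (e : V n)⟫} with hDdef
  have hD : MeasurableSet D := by
    apply measurableSet_le measurable_const
    fun_prop
  have hle : Measure.map (dblS u) ((sphMeas n).restrict D) ≤ ENNReal.ofReal (5 ^ n) • sphMeas n := by
    rw [Measure.le_iff]
    intro B hB
    rw [Measure.map_apply (measurable_dblS u) hB, Measure.restrict_apply (measurable_dblS u hB),
      Measure.smul_apply, smul_eq_mul, sphMeas,
      Measure.toSphere_apply' _ ((measurable_dblS u hB).inter hD), Measure.toSphere_apply' _ hB,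
      mul_left_comm]
    gcongr
    refine vol_expand _ _ (fun y => ‖y‖ • dbl u (‖y‖⁻¹ • y)) 5 (by norm_num) ?_ ?_
    · rintro _ ⟨r, hr, _, ⟨e, he, rfl⟩, rfl⟩
      refine ⟨r, hr, _, ⟨dblS u e, he.1, rfl⟩, ?_⟩
      have hr0 : 0 < r := hr.1
      simp [norm_smul, abs_of_pos hr0, smul_smul, hr0.ne', dblS]
    · rintro _ ⟨r, hr, _, ⟨e, he, rfl⟩, rfl⟩ _ ⟨r', hr', _, ⟨e', he', rfl⟩, rfl⟩
      have hr0 : 0 < r := hr.1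
      have hr0' : 0 < r' := hr'.1
      have hen : ‖(e : V n)‖ = 1 := by simp
      have hen' : ‖(e' : V n)‖ = 1 := by simp
      have E := dbl_expand (u : V n) e e' hu hen hen' he.2 he'.2
      simp only [norm_smul, Real.norm_eq_abs, abs_of_pos hr0, abs_of_pos hr0', smul_smul, hen, hen',
        mul_one, inv_mul_cancel₀ hr0.ne', inv_mul_cancel₀ hr0'.ne', one_smul]
      have hs := norm_dbl (u : V n) e hu hen
      have hs' := norm_dbl (u : V n) e' hu hen'
      set σ := dbl (u : V n) e
      set σ' := dbl (u : V n) e'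
      have a1 : |r - r'| ≤ ‖r • σ - r' • σ'‖ := by
        have := abs_norm_sub_norm_le (r • σ) (r' • σ')
        rwa [norm_smul, norm_smul, hs, hs', mul_one, mul_one, Real.norm_eq_abs, Real.norm_eq_abs,
          abs_of_pos hr0, abs_of_pos hr0'] at this
      have a2 : r * ‖σ - σ'‖ ≤ ‖r • σ - r' • σ'‖ + |r - r'| := by
        have e1 : r • (σ - σ') = (r • σ - r' • σ') + (r' - r) • σ' := by module
        have := norm_add_le (r • σ - r' • σ') ((r' - r) • σ')
        rw [← e1, norm_smul, norm_smul, hs', mul_one, Real.norm_eq_abs, Real.norm_eq_abs,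
          abs_of_pos hr0, abs_sub_comm] at this
        exact this
      have a3 : ‖r • (e : V n) - r' • (e' : V n)‖ ≤ r * ‖(e : V n) - e'‖ + |r - r'| := by
        have e1 : r • (e : V n) - r' • (e' : V n) = r • ((e : V n) - e') + (r - r') • (e' : V n) := by
          module
        have := norm_add_le (r • ((e : V n) - e')) ((r - r') • (e' : V n))
        rwa [← e1, norm_smul, norm_smul, hen', mul_one, Real.norm_eq_abs, Real.norm_eq_abs,
          abs_of_pos hr0] at this
      have a4 : r * ‖(e : V n) - e'‖ ≤ r * (2 * ‖σ - σ'‖) := by gcongr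
      have : ‖r • (e : V n) - r' • (e' : V n)‖ ≤ 5 * ‖r • σ - r' • σ'‖ := by linarith
      simpa using this
  calc _ = ∫⁻ e in D, h (dblS u e) ∂(sphMeas n) := by
        rw [← lintegral_indicator hD]
        rfl
    _ ≤ _ := by
        rw [← lintegral_map hh (measurable_dblS u), ← smul_eq_mul, ← lintegral_smul_measure]
        exact lintegral_mono' hle le_rfl

end

noncomputable section

/-- swapping one coordinate with an extra variable, through three shears -/
lemma shear_swap {n : ℕ} (e : V n) (he : ‖e‖ = 1) (K : V n → ℝ → ℝ≥0∞)
    (hK : Measurable (Function.uncurry K)) :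
    ∫⁻ u, ∫⁻ x, K u x = ∫⁻ t : ℝ, ∫⁻ y, K (y + (t - ⟪y, e⟫) • e) (⟪y, e⟫) := by
  have hee : ⟪e, e⟫ = 1 := by rw [real_inner_self_eq_norm_sq, he]; norm_num
  have m1 : ∀ {X : Type} [MeasurableSpace X] (φ : X → V n) (ψ : X → ℝ), Measurable φ → Measurable ψ →
      Measurable (fun z => K (φ z) (ψ z)) := fun φ ψ hφ hψ => hK.comp (hφ.prodMk hψ)
  calc ∫⁻ u, ∫⁻ x, K u x = ∫⁻ u, ∫⁻ x, K u (-x) := by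
        congr 1; ext u
        rw [lintegral_neg_eq_self (μ := volume) (fun x => K u x)]
    _ = ∫⁻ x, ∫⁻ u, K u (-x) :=
        lintegral_lintegral_swap (m1 _ _ (by fun_prop) (by fun_prop)).aemeasurable
    _ = ∫⁻ x : ℝ, ∫⁻ u, K (u + x • e) (-x) := by
        congr 1; ext x
        rw [lintegral_add_right_eq_self (fun u => K u (-x)) (x • e)]
    _ = ∫⁻ u, ∫⁻ x : ℝ, K (u + x • e) (-x) :=
        lintegral_lintegral_swap (m1 _ _ (by fun_prop) (by fun_prop)).aemeasurable
    _ = ∫⁻ u, ∫⁻ x : ℝ, K (u + (x + -⟪u, e⟫) • e) (-(x + -⟪u, e⟫)) := by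
        congr 1; ext u
        rw [lintegral_add_right_eq_self (fun x => K (u + x • e) (-x)) (-⟪u, e⟫)]
    _ = ∫⁻ x : ℝ, ∫⁻ u, K (u + (x + -⟪u, e⟫) • e) (-(x + -⟪u, e⟫)) :=
        lintegral_lintegral_swap (m1 _ _ (by fun_prop) (by fun_prop)).aemeasurable
    _ = ∫⁻ x : ℝ, ∫⁻ u, K ((u + x • e) + (x + -⟪u + x • e, e⟫) • e) (-(x + -⟪u + x • e, e⟫)) := by
        congr 1; ext x
        rw [lintegral_add_right_eq_self
          (fun u => K (u + (x + -⟪u, e⟫) • e) (-(x + -⟪u, e⟫))) (x • e)]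
    _ = _ := by
        congr 1; ext x; congr 1; ext u
        have : ⟪u + x • e, e⟫ = ⟪u, e⟫ + x := by
          rw [inner_add_left, inner_smul_left, hee]; simp
        rw [this]
        congr 1
        · module
        · ring

/-- polar coordinates -/
lemma polar {n : ℕ} (hn : 2 ≤ n) (G : V n → ℝ≥0∞) (hG : Measurable G) :
    ∫⁻ v, G v = ∫⁻ e : sphere (0 : V n) 1, (∫⁻ t in Ioi (0 : ℝ),
      ENNReal.ofReal (t ^ (n - 1)) * G (t • (e : V n))) ∂(sphMeas n) := by
  have : Nontrivial (V n) := by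
    have : Nonempty (Fin n) := ⟨⟨0, by omega⟩⟩
    infer_instance
  have hfr : Module.finrank ℝ (V n) = n := by simp
  have hmp := (volume : Measure (V n)).measurePreserving_homeomorphUnitSphereProd
  have h1 : ∫⁻ v, G v = ∫⁻ x : ({(0)}ᶜ : Set (V n)), G x.1 ∂((volume : Measure (V n)).comap (↑)) := by
    rw [lintegral_subtype_comap (measurableSet_singleton _).compl G, restrict_compl_singleton]
  have h2 := hmp.lintegral_comp (f := fun z => G (z.2.1 • (z.1 : V n))) (by fun_prop)
  have h3 : ∀ x : ({(0)}ᶜ : Set (V n)), ((homeomorphUnitSphereProd (V n) x).2.1 •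
      ((homeomorphUnitSphereProd (V n) x).1 : V n)) = x.1 := by
    intro x
    have hx : ‖x.1‖ ≠ 0 := norm_ne_zero_iff.2 x.2
    simp [smul_smul, hx]
  simp only [h3] at h2
  rw [h1, h2, lintegral_prod _ (by fun_prop), hfr, sphMeas]
  congr 1; ext e
  rw [Measure.volumeIoiPow, lintegral_withDensity_eq_lintegral_mul _ (by fun_prop) (by fun_prop)]
  simp only [Pi.mul_apply]
  rw [lintegral_subtype_comap measurableSet_Ioi
    (fun t : ℝ => ENNReal.ofReal (t ^ (n-1)) * G (t • (e : V n)))]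

/-- one-dimensional kernel integral -/
lemma kernel_1d (q p : ℝ) (hq : 2 ≤ q) (hp : 0 < p) :
    ∫⁻ x : ℝ, ENNReal.ofReal (√(x ^ 2 + p ^ 2) ^ (-q)) ≤
      ENNReal.ofReal (π * p ^ (1 - q)) := by
  have hb : ∀ x : ℝ, √(x ^ 2 + p ^ 2) ^ (-q) ≤ p ^ (-q) * (1 + (p⁻¹ * x) ^ 2)⁻¹ := by
    intro x
    have e : √(x ^ 2 + p ^ 2) = p * √(1 + (p⁻¹ * x) ^ 2) := by
      rw [← Real.sqrt_sq hp.le, ← Real.sqrt_mul (sq_nonneg p), Real.sqrt_sq hp.le]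
      congr 1; field_simp; ring
    rw [e, Real.mul_rpow hp.le (Real.sqrt_nonneg _)]
    gcongr
    have h1 : 1 ≤ √(1 + (p⁻¹ * x) ^ 2) := by
      rw [Real.one_le_sqrt]; nlinarith [sq_nonneg (p⁻¹ * x)]
    calc √(1 + (p⁻¹ * x) ^ 2) ^ (-q) ≤ √(1 + (p⁻¹ * x) ^ 2) ^ (-2 : ℝ) :=
          Real.rpow_le_rpow_of_exponent_le h1 (by linarith)
      _ = _ := by
          rw [Real.rpow_neg (Real.sqrt_nonneg _), Real.rpow_two, Real.sq_sqrt (by positivity)]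
  calc ∫⁻ x : ℝ, ENNReal.ofReal (√(x ^ 2 + p ^ 2) ^ (-q))
      ≤ ∫⁻ x : ℝ, ENNReal.ofReal (p ^ (-q) * (1 + (p⁻¹ * x) ^ 2)⁻¹) :=
        lintegral_mono fun x => ENNReal.ofReal_le_ofReal (hb x)
    _ = ENNReal.ofReal (∫ x : ℝ, p ^ (-q) * (1 + (p⁻¹ * x) ^ 2)⁻¹) := by
        rw [ofReal_integral_eq_lintegral_ofReal]
        · exact (integrable_inv_one_add_sq.comp_mul_left' (inv_ne_zero hp.ne')).const_mul _
        · exact Filter.Eventually.of_forall fun x => by positivity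
    _ ≤ _ := by
        apply le_of_eq
        congr 1
        rw [integral_const_mul, Measure.integral_comp_mul_left (fun x => (1 + x ^ 2)⁻¹) p⁻¹,
          integral_univ_inv_one_add_sq, inv_inv, abs_of_pos hp, smul_eq_mul,
          show (1 - q : ℝ) = -q + 1 by ring, Real.rpow_add_one hp.ne']
        ring

end

noncomputable section

/-- projection onto the orthogonal complement of `α` -/
def pr {n : ℕ} (α y : V n) : V n := y - (⟪α, y⟫ / ‖α‖ ^ 2) • α

lemma rpow_comp (x y K r : ℝ) (hx : 0 < x) (hy : 0 < y) (hK : 1 ≤ K) (h1 : x ≤ K * y)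
    (h2 : y ≤ K * x) : y ^ r ≤ K ^ |r| * x ^ r := by
  have hK0 : 0 < K := by linarith
  rcases le_total 0 r with hr | hr
  · rw [abs_of_nonneg hr, ← Real.mul_rpow hK0.le hx.le]
    exact Real.rpow_le_rpow hy.le h2 hr
  · rw [abs_of_nonpos hr, Real.rpow_neg hK0.le, ← Real.inv_rpow hK0.le,
      ← Real.mul_rpow (by positivity) hx.le]
    apply Real.rpow_le_rpow_of_nonpos (by positivity) _ hr
    rw [inv_mul_le_iff₀ hK0]
    exact h1

lemma ker_lower {n : ℕ} (hn : 2 ≤ n) {s cb : ℝ} (hs : 0 < s) (hcb : 0 < cb) {b : ℝ → ℝ}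
    (hb : KernelAssumptions n s cb b) (c : ℝ) (hc0 : 0 < c) (hc1 : c < 1) (hc2 : 1 / 2 ≤ c ^ 2) :
    cb * (π * √(1 - c ^ 2)) ^ (-((n : ℝ) - 1 + 2 * s)) ≤ b (2 * c ^ 2 - 1) := by
  set φ := arccos c with hφ
  have hφ0 : 0 < φ := Real.arccos_pos.2 hc1
  have hcos : cos φ = c := Real.cos_arccos (by linarith) hc1.le
  have hsin : sin φ = √(1 - c ^ 2) := Real.sin_arccos c
  have hφ4 : φ ≤ π / 4 := by
    rw [hφ, ← Real.arccos_cos (x := π / 4) (by positivity) (by linarith [pi_pos])]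
    apply Real.arccos_le_arccos
    rw [Real.cos_pi_div_four]
    have : (√2 / 2) ^ 2 ≤ c ^ 2 := by
      rw [div_pow, Real.sq_sqrt (by norm_num)]; linarith
    exact le_of_sq_le_sq this hc0.le
  have hθ : 2 * φ ∈ Ioc 0 (π / 2) := ⟨by linarith, by linarith⟩
  have h := (hb.2.2.2 (2 * φ) hθ).1
  rw [Real.cos_two_mul, hcos] at h
  set B := b (2 * c ^ 2 - 1)
  have hB : 0 ≤ B := hb.2.1 _
  have hn' : (0 : ℝ) ≤ (n : ℝ) - 2 := by
    have : (2 : ℝ) ≤ n := by exact_mod_cast hn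
    linarith
  have hθ0 : 0 < 2 * φ := hθ.1
  have hsθ : 0 ≤ sin (2 * φ) := (Real.sin_pos_of_pos_of_lt_pi hθ.1 (by linarith [hθ.2, pi_pos])).le
  have h3 : sin (2 * φ) ^ ((n : ℝ) - 2) * B ≤ (2 * φ) ^ ((n : ℝ) - 2) * B := by
    gcongr
    exact Real.sin_le hθ0.le
  have h4 : cb * (2 * φ) ^ (-((n : ℝ) - 1 + 2 * s)) ≤ B := by
    have e : (2 * φ) ^ (-((n : ℝ) - 1 + 2 * s)) =
        (2 * φ) ^ (-(1 + 2 * s)) / (2 * φ) ^ ((n : ℝ) - 2) := by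
      rw [← Real.rpow_sub hθ0]; congr 1; ring
    rw [e, ← mul_div_assoc, div_le_iff₀ (by positivity), mul_comm B]
    exact h.trans h3
  refine le_trans ?_ h4
  apply mul_le_mul_of_nonneg_left _ hcb.le
  apply Real.rpow_le_rpow_of_nonpos hθ0
  · rw [← hsin]
    have := Real.mul_le_sin hφ0.le (by linarith)
    have hp := pi_pos
    have : π * (2 / π * φ) ≤ π * sin φ := by gcongr
    have e : π * (2 / π * φ) = 2 * φ := by field_simp
    linarith
  · linarith

lemma inner_dbl {n : ℕ} (u e : V n) (hu : ‖u‖ = 1) : ⟪u, dbl u e⟫ = 2 * ⟪u, e⟫ ^ 2 - 1 := by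
  rw [dbl, inner_sub_right, inner_smul_right, real_inner_self_eq_norm_sq, hu]; ring

lemma carleman_pt {n : ℕ} (hn : 2 ≤ n) {s γ CΦ cb : ℝ} (hs : 0 < s) (hCΦ : 0 < CΦ) (hcb : 0 < cb)
    {b : ℝ → ℝ} (hb : KernelAssumptions n s cb b) (u e : V n) (he : ‖e‖ = 1)
    (t : ℝ) (ht : t = ⟪u, e⟫) (ht0 : 0 < t) (P : ℝ) (hP : P = ‖u - t • e‖)
    (hPt : P ≤ t) (hP0 : 0 < P) :
    (1 / 2 : ℝ) ≤ ⟪‖u‖⁻¹ • u, e⟫ ∧ vprime u 0 (dbl (‖u‖⁻¹ • u) e) = t • e ∧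
    t ^ (n - 1) * t ^ (γ + 2 * s) * (π * P ^ (1 - ((n : ℝ) + 2 * s))) ≤
      (π * π ^ ((n : ℝ) - 1 + 2 * s) * 2 ^ |γ + ((n : ℝ) - 1 + 2 * s)| / (CΦ * cb)) *
        Bker CΦ γ b u 0 (dbl (‖u‖⁻¹ • u) e) := by
  have hP2 : P ^ 2 = ‖u‖ ^ 2 - t ^ 2 := by
    rw [hP, norm_sub_sq_real, norm_smul, inner_smul_right, he, ← ht, Real.norm_eq_abs, mul_one,
      sq_abs]
    ring
  set r := ‖u‖ with hr
  have hr0 : 0 < r := by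
    have : 0 ≤ r := norm_nonneg _
    rcases this.eq_or_lt with h | h
    · rw [← h] at hP2; nlinarith
    · exact h
  have hc : ⟪r⁻¹ • u, e⟫ = t / r := by
    rw [inner_smul_left, ← ht]; simp; field_simp
  have hûn : ‖r⁻¹ • u‖ = 1 := by
    rw [norm_smul, ← hr, Real.norm_eq_abs, abs_of_pos (by positivity), inv_mul_cancel₀ hr0.ne']
  have hc2 : 1 / 2 ≤ (t / r) ^ 2 := by
    rw [div_pow, le_div_iff₀ (by positivity)]; nlinarith
  have hc0 : 0 < t / r := by positivity
  have htr : t < r := by nlinarith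
  have hc1 : t / r < 1 := by rw [div_lt_one hr0]; exact htr
  refine ⟨?_, ?_, ?_⟩
  · rw [hc]; nlinarith
  · rw [vprime, dbl, hc, sub_zero, ← hr]
    match_scalars
    · field_simp
      ring
    · field_simp
  · have hk := ker_lower hn hs hcb hb (t / r) hc0 hc1 hc2
    rw [Bker, sub_zero, ← hr, inner_dbl _ _ hûn, hc]
    have hq : √(1 - (t / r) ^ 2) = P / r := by
      rw [show 1 - (t / r) ^ 2 = (P / r) ^ 2 by rw [div_pow, div_pow, hP2]; field_simp]
      exact Real.sqrt_sq (by positivity)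
    rw [hq] at hk
    set w := (n : ℝ) - 1 + 2 * s with hw
    have e1 : t ^ (n - 1) * t ^ (γ + 2 * s) = t ^ (γ + w) := by
      rw [← Real.rpow_natCast, ← Real.rpow_add ht0]
      congr 1
      rw [Nat.cast_sub (by omega)]; push_cast; rw [hw]; ring
    have e2 : 1 - ((n : ℝ) + 2 * s) = -w := by rw [hw]; ring
    have e3 : t ^ (γ + w) ≤ 2 ^ |γ + w| * r ^ (γ + w) :=
      rpow_comp r t 2 _ hr0 ht0 (by norm_num) (by
        rw [div_pow, le_div_iff₀ (by positivity)] at hc2; nlinarith) (by linarith)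
    rw [e1, e2]
    have e4 : (π * (P / r)) ^ (-w) = (π ^ w)⁻¹ * P ^ (-w) * r ^ w := by
      rw [Real.mul_rpow pi_pos.le (by positivity), Real.div_rpow hP0.le hr0.le,
        Real.rpow_neg pi_pos.le, Real.rpow_neg hr0.le]
      field_simp
    rw [e4] at hk
    have hπw : 0 < π ^ w := by positivity
    calc t ^ (γ + w) * (π * P ^ (-w)) ≤ (2 ^ |γ + w| * r ^ (γ + w)) * (π * P ^ (-w)) := by gcongr
      _ = (π * π ^ w * 2 ^ |γ + w| / (CΦ * cb)) * (CΦ * r ^ γ *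
          (cb * ((π ^ w)⁻¹ * P ^ (-w) * r ^ w))) := by
          rw [Real.rpow_add hr0]; field_simp
      _ ≤ _ := by gcongr

end

noncomputable section

lemma measurable_pr {n : ℕ} : Measurable (fun p : V n × V n => pr p.1 p.2) := by
  unfold pr; fun_prop

lemma measurable_vprime {n : ℕ} : Measurable (fun p : V n × V n × V n => vprime p.1 p.2.1 p.2.2) := by
  unfold vprime; fun_prop

lemma measurable_Bker {n : ℕ} (CΦ γ : ℝ) {b : ℝ → ℝ} (hb : Measurable b) :
    Measurable (fun p : V n × V n × V n => Bker CΦ γ b p.1 p.2.1 p.2.2) := by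
  unfold Bker; fun_prop

lemma measurable_ite' {X : Type*} [MeasurableSpace X] {p : X → Prop} [DecidablePred p]
    {f g : X → ℝ≥0∞} (hp : MeasurableSet {x | p x}) (hf : Measurable f) (hg : Measurable g) :
    Measurable (fun x => if p x then f x else g x) := Measurable.ite hp hf hg

lemma measurableSet_and' {X : Type*} [MeasurableSpace X] {p q : X → Prop}
    (hp : MeasurableSet {x | p x}) (hq : MeasurableSet {x | q x}) :
    MeasurableSet {x | p x ∧ q x} := hp.inter hq

def carC (n : ℕ) (s γ CΦ cb : ℝ) : ℝ :=
  π * π ^ ((n : ℝ) - 1 + 2 * s) * 2 ^ |γ + ((n : ℝ) - 1 + 2 * s)| / (CΦ * cb)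

/-- the sheared kernel -/
def carK {n : ℕ} (s γ : ℝ) (F : V n → V n → ℝ≥0∞) (e u : V n) (x : ℝ) : ℝ≥0∞ :=
  if 0 < ⟪u, e⟫ ∧ ‖u - ⟪u, e⟫ • e‖ ≤ ⟪u, e⟫ then
    ENNReal.ofReal (⟪u, e⟫ ^ (n - 1) * ⟪u, e⟫ ^ (γ + 2 * s)) *
      ENNReal.ofReal (√(x ^ 2 + ‖u - ⟪u, e⟫ • e‖ ^ 2) ^ (-((n : ℝ) + 2 * s))) *
      F (⟪u, e⟫ • e) u
  else 0

def carL {n : ℕ} (s γ : ℝ) (F : V n → V n → ℝ≥0∞) (e u : V n) : ℝ≥0∞ :=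
  if 0 < ⟪u, e⟫ ∧ ‖u - ⟪u, e⟫ • e‖ ≤ ⟪u, e⟫ ∧ 0 < ‖u - ⟪u, e⟫ • e‖ then
    ENNReal.ofReal (⟪u, e⟫ ^ (n - 1) * ⟪u, e⟫ ^ (γ + 2 * s) *
      (π * ‖u - ⟪u, e⟫ • e‖ ^ (1 - ((n : ℝ) + 2 * s)))) *
      F (⟪u, e⟫ • e) u
  else 0

lemma measurable_carK {n : ℕ} (s γ : ℝ) {F : V n → V n → ℝ≥0∞}
    (hF : Measurable (Function.uncurry F)) (e : V n) :
    Measurable (Function.uncurry (carK s γ F e)) := by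
  unfold carK Function.uncurry
  refine measurable_ite' ?_ ?_ measurable_const
  · refine measurableSet_and' (measurableSet_lt ?_ ?_) (measurableSet_le ?_ ?_) <;> fun_prop
  · refine Measurable.mul (by fun_prop) ?_
    exact hF.comp (g := Function.uncurry F) (f := fun a : V n × ℝ => (⟪a.1, e⟫ • e, a.1)) (by fun_prop)

lemma measurable_carL {n : ℕ} (s γ : ℝ) {F : V n → V n → ℝ≥0∞}
    (hF : Measurable (Function.uncurry F)) :
    Measurable (fun p : V n × V n => carL s γ F p.1 p.2) := by
  unfold carL
  refine measurable_ite' ?_ ?_ measurable_const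
  · refine measurableSet_and' (measurableSet_lt ?_ ?_)
      (measurableSet_and' (measurableSet_le ?_ ?_) (measurableSet_lt ?_ ?_)) <;> fun_prop
  · refine Measurable.mul (by fun_prop) ?_
    exact hF.comp (g := Function.uncurry F) (f := fun a : V n × V n => (⟪a.2, a.1⟫ • a.1, a.2))
      (by fun_prop)

lemma carK_le {n : ℕ} (hn : 2 ≤ n) {s γ : ℝ} (hs : 0 < s) {F : V n → V n → ℝ≥0∞}
    (hF0 : ∀ v, F v v = 0) (e u : V n) : ∫⁻ x, carK s γ F e u x ≤ carL s γ F e u := by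
  unfold carK carL
  by_cases h : 0 < ⟪u, e⟫ ∧ ‖u - ⟪u, e⟫ • e‖ ≤ ⟪u, e⟫
  · by_cases h0 : 0 < ‖u - ⟪u, e⟫ • e‖
    · simp only [h, h0, and_self, if_true]
      rw [lintegral_mul_const _ (by fun_prop), lintegral_const_mul _ (by fun_prop)]
      gcongr
      rw [ENNReal.ofReal_mul (p := _ * _) (by have := h.1; positivity)]
      gcongr
      refine kernel_1d _ _ ?_ h0
      have : (2 : ℝ) ≤ n := by exact_mod_cast hn
      linarith
    · have h1 : u - ⟪u, e⟫ • e = 0 := by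
        rw [← norm_eq_zero]; exact le_antisymm (not_lt.1 h0) (norm_nonneg _)
      have h2 : ⟪u, e⟫ • e = u := (sub_eq_zero.1 h1).symm
      rw [h2, hF0]
      simp
  · simp only [h, if_false, lintegral_zero]; simp

lemma carleman0 {n : ℕ} (hn : 2 ≤ n) {s γ CΦ cb : ℝ} (hs : 0 < s) (hCΦ : 0 < CΦ) (hcb : 0 < cb)
    {b : ℝ → ℝ} (hb : KernelAssumptions n s cb b) (F : V n → V n → ℝ≥0∞)
    (hF : Measurable (Function.uncurry F)) (hF0 : ∀ v, F v v = 0) :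
    ∫⁻ v, ∫⁻ y, (if ‖y‖ ≤ ‖v‖ then
        ENNReal.ofReal (‖v‖ ^ (γ + 2 * s) * ‖y‖ ^ (-((n : ℝ) + 2 * s))) * F v (v + pr v y) else 0) ≤
      ENNReal.ofReal (5 ^ n * carC n s γ CΦ cb) * ∫⁻ u, ∫⁻ σ : sphere (0 : V n) 1,
        ENNReal.ofReal (Bker CΦ γ b u 0 σ) * F (vprime u 0 σ) u ∂(sphMeas n) := by
  have hmeas : Measurable (fun p : V n × V n => if ‖p.2‖ ≤ ‖p.1‖ then
        ENNReal.ofReal (‖p.1‖ ^ (γ + 2 * s) * ‖p.2‖ ^ (-((n : ℝ) + 2 * s))) *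
          F p.1 (p.1 + pr p.1 p.2) else 0) := by
    refine measurable_ite' (measurableSet_le (by fun_prop) (by fun_prop)) ?_ measurable_const
    refine Measurable.mul (by fun_prop) ?_
    have := measurable_pr (n := n)
    exact hF.comp (g := Function.uncurry F) (f := fun p : V n × V n => (p.1, p.1 + pr p.1 p.2))
      (by fun_prop)
  rw [polar hn _ hmeas.lintegral_prod_right']
  have hC0 : 0 ≤ carC n s γ CΦ cb := by unfold carC; positivity
  have step1 : ∀ e : sphere (0 : V n) 1, (∫⁻ t in Ioi (0 : ℝ), ENNReal.ofReal (t ^ (n - 1)) *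
      ∫⁻ y, (if ‖y‖ ≤ ‖t • (e : V n)‖ then
        ENNReal.ofReal (‖t • (e : V n)‖ ^ (γ + 2 * s) * ‖y‖ ^ (-((n : ℝ) + 2 * s))) *
          F (t • (e : V n)) (t • (e : V n) + pr (t • (e : V n)) y) else 0)) ≤
      ∫⁻ u, carL s γ F e u := by
    intro e
    have he : ‖(e : V n)‖ = 1 := by simp
    have hee : ⟪(e : V n), e⟫ = 1 := by rw [real_inner_self_eq_norm_sq, he]; norm_num
    refine le_trans ?_ (lintegral_mono (fun u => carK_le hn hs hF0 (e : V n) u))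
    rw [shear_swap (e : V n) he (carK s γ F (e : V n)) (measurable_carK s γ hF (e : V n))]
    refine le_trans (setLIntegral_mono' measurableSet_Ioi (g := fun t => ∫⁻ y : V n,
      carK s γ F (e : V n) (y + (t - ⟪y, (e : V n)⟫) • (e : V n)) ⟪y, (e : V n)⟫) ?_) (setLIntegral_le_lintegral _ _)
    intro t ht
    have ht0 : 0 < t := ht
    rw [← lintegral_const_mul' _ _ ENNReal.ofReal_ne_top]
    apply lintegral_mono
    intro y
    have hte : ‖t • (e : V n)‖ = t := by rw [norm_smul, he, mul_one]; exact abs_of_pos ht0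
    have hu : ⟪y + (t - ⟪y, (e : V n)⟫) • (e : V n), (e : V n)⟫ = t := by
      rw [inner_add_left, inner_smul_left, hee]; simp
    have hp : y + (t - ⟪y, (e : V n)⟫) • (e : V n) - t • (e : V n) = y - ⟪y, (e : V n)⟫ • (e : V n) := by
      module
    have hpr : t • (e : V n) + pr (t • (e : V n)) y = y + (t - ⟪y, (e : V n)⟫) • (e : V n) := by
      rw [pr, hte, inner_smul_left, real_inner_comm]
      simp only [conj_trivial]
      match_scalars
      · field_simp; ring
      · field_simp
    have hpn : ‖y - ⟪y, (e : V n)⟫ • (e : V n)‖ ^ 2 = ‖y‖ ^ 2 - ⟪y, (e : V n)⟫ ^ 2 := by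
      rw [norm_sub_sq_real, norm_smul, inner_smul_right, he, Real.norm_eq_abs, mul_one, sq_abs]
      ring
    simp only [hte]
    unfold carK
    rw [hu, hp, hpn, hpr]
    by_cases hy : ‖y‖ ≤ t
    · have hc : ‖y - ⟪y, (e : V n)⟫ • (e : V n)‖ ≤ t := by
        refine le_trans ?_ hy
        apply le_of_sq_le_sq _ (norm_nonneg _)
        rw [hpn]; nlinarith [sq_nonneg ⟪y, (e : V n)⟫]
      simp only [hy, hc, ht0, and_self, if_true]
      rw [← mul_assoc]
      refine mul_le_mul_left ?_ _
      rw [show ⟪y, (e : V n)⟫ ^ 2 + (‖y‖ ^ 2 - ⟪y, (e : V n)⟫ ^ 2) = ‖y‖ ^ 2 by ring,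
        Real.sqrt_sq (norm_nonneg _), ← ENNReal.ofReal_mul (by positivity),
        ← ENNReal.ofReal_mul (by positivity), mul_assoc]
    · simp [hy]
  refine le_trans (lintegral_mono step1) ?_
  rw [lintegral_lintegral_swap]
  swap
  · have := measurable_carL s γ hF
    exact (this.comp (f := fun p : sphere (0 : V n) 1 × V n => ((p.1 : V n), p.2))
      (by fun_prop)).aemeasurable
  rw [← lintegral_const_mul' _ _ ENNReal.ofReal_ne_top]
  apply lintegral_mono
  intro u
  simp only
  by_cases hu0 : u = 0
  · have : ∀ e : sphere (0 : V n) 1, carL s γ F e u = 0 := by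
      intro e; simp [carL, hu0]
    simp [this]
  have hun : ‖‖u‖⁻¹ • u‖ = 1 := norm_smul_inv_norm (𝕜 := ℝ) hu0
  let U : sphere (0 : V n) 1 := ⟨‖u‖⁻¹ • u, by simpa using hun⟩
  have hh : Measurable (fun σ : sphere (0 : V n) 1 => ENNReal.ofReal (carC n s γ CΦ cb) *
      (ENNReal.ofReal (Bker CΦ γ b u 0 σ) * F (vprime u 0 σ) u)) := by
    have h1 := measurable_vprime (n := n)
    have h2 := measurable_Bker (n := n) CΦ γ hb.1
    have h3 : Measurable (fun σ : sphere (0 : V n) 1 => Bker CΦ γ b u 0 σ) :=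
      h2.comp (f := fun σ : sphere (0 : V n) 1 => (u, (0 : V n), (σ : V n))) (by fun_prop)
    have h4 : Measurable (fun σ : sphere (0 : V n) 1 => vprime u 0 (σ : V n)) :=
      h1.comp (f := fun σ : sphere (0 : V n) 1 => (u, (0 : V n), (σ : V n))) (by fun_prop)
    have h5 : Measurable (fun σ : sphere (0 : V n) 1 => F (vprime u 0 σ) u) :=
      hF.comp (g := Function.uncurry F) (f := fun σ : sphere (0 : V n) 1 => (vprime u 0 σ, u))
        (by fun_prop)
    fun_prop
  have key := sphere_change U _ hh
  rw [lintegral_const_mul' _ _ ENNReal.ofReal_ne_top, ← mul_assoc,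
    ← ENNReal.ofReal_mul (by positivity)] at key
  refine le_trans (lintegral_mono ?_) key
  intro e
  have he : ‖(e : V n)‖ = 1 := by simp
  unfold carL
  simp only
  split_ifs with h1 h2 h2
  · obtain ⟨-, k2, k3⟩ := carleman_pt hn (γ := γ) hs hCΦ hcb hb u e he _ rfl h1.1 _ rfl h1.2.1 h1.2.2
    have hd : ((dblS U e : sphere (0 : V n) 1) : V n) = dbl (‖u‖⁻¹ • u) e := rfl
    rw [hd, k2, ← mul_assoc (ENNReal.ofReal (carC n s γ CΦ cb)), ← ENNReal.ofReal_mul hC0]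
    exact mul_le_mul_left (ENNReal.ofReal_le_ofReal k3) _
  · obtain ⟨k1, -, -⟩ := carleman_pt hn (γ := γ) hs hCΦ hcb hb u e he _ rfl h1.1 _ rfl h1.2.1 h1.2.2
    exact absurd k1 h2
  · exact zero_le
  · exact le_rfl

/-- the Boltzmann functional at fixed `v_* = a`. -/
def Ia {n : ℕ} (CΦ γ : ℝ) (b : ℝ → ℝ) (f : V n → ℝ) (a : V n) : ℝ≥0∞ :=
  ∫⁻ v : V n, ∫⁻ σ : sphere (0 : V n) 1,
    ENNReal.ofReal (Bker CΦ γ b v a σ) * ENNReal.ofReal ((f (vprime v a σ) - f v) ^ 2) ∂(sphMeas n)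

def Ja {n : ℕ} (s γ : ℝ) (f : V n → ℝ) (a : V n) : ℝ≥0∞ :=
  ∫⁻ v : V n, ∫⁻ y, (if ‖y‖ ≤ ‖v - a‖ then
        ENNReal.ofReal (‖v - a‖ ^ (γ + 2 * s) * ‖y‖ ^ (-((n : ℝ) + 2 * s))) *
          ENNReal.ofReal ((f (v + pr (v - a) y) - f v) ^ 2) else 0)

lemma carleman {n : ℕ} (hn : 2 ≤ n) {s γ CΦ cb : ℝ} (hs : 0 < s) (hCΦ : 0 < CΦ) (hcb : 0 < cb)
    {b : ℝ → ℝ} (hb : KernelAssumptions n s cb b) (f : V n → ℝ) (hf : Measurable f) (a : V n) :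
    Ja s γ f a ≤ ENNReal.ofReal (5 ^ n * carC n s γ CΦ cb) * Ia CΦ γ b f a := by
  have h := carleman0 hn (γ := γ) hs hCΦ hcb hb
    (fun v w => ENNReal.ofReal ((f (w + a) - f (v + a)) ^ 2)) (by unfold Function.uncurry; fun_prop)
    (by simp)
  have e1 : Ja s γ f a = _ := (lintegral_add_right_eq_self (μ := (volume : Measure (V n))) _ a).symm
  have e2 : Ia CΦ γ b f a = _ :=
    (lintegral_add_right_eq_self (μ := (volume : Measure (V n))) _ a).symm
  rw [e1, e2]
  convert h using 6 with v y v
  · simp only [add_sub_cancel_right]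
  · simp only [add_sub_cancel_right]
    rw [add_right_comm]
  · rename_i v σ
    congr 2
    · simp [Bker]
    · have : vprime (v + a) a σ = vprime v 0 σ + a := by
        rw [vprime, vprime, add_sub_cancel_right, sub_zero]; module
      rw [this]; ring
end

noncomputable section

section prlemmas
variable {n : ℕ} (α x y : V n)

lemma inner_pr : ⟪α, pr α y⟫ = 0 := by
  by_cases h : α = 0
  · simp [h]
  · have : ‖α‖ ≠ 0 := norm_ne_zero_iff.2 h
    rw [pr, inner_sub_right, inner_smul_right, real_inner_self_eq_norm_sq]
    field_simp; ring

lemma pr_add : pr α (x + y) = pr α x + pr α y := by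
  simp only [pr, inner_add_right, add_div]; module

lemma pr_smul (c : ℝ) : pr α (c • x) = c • pr α x := by
  simp only [pr, inner_smul_right, mul_div_assoc]; module

lemma pr_sub : pr α (x - y) = pr α x - pr α y := by
  simp only [pr, inner_sub_right, sub_div]; module

lemma pr_self : pr α α = 0 := by
  by_cases h : α = 0
  · simp [h, pr]
  · have : ‖α‖ ≠ 0 := norm_ne_zero_iff.2 h
    rw [pr, real_inner_self_eq_norm_sq, div_self (by positivity)]; simp

lemma pr_of_inner (h : ⟪α, y⟫ = 0) : pr α y = y := by simp [pr, h]

lemma norm_pr_sq : ‖α‖ ^ 2 * ‖pr α y‖ ^ 2 = ‖α‖ ^ 2 * ‖y‖ ^ 2 - ⟪α, y⟫ ^ 2 := by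
  by_cases h : α = 0
  · simp [h]
  · have : ‖α‖ ≠ 0 := norm_ne_zero_iff.2 h
    have e : ‖pr α y‖ ^ 2 = ‖y‖ ^ 2 - ⟪α, y⟫ ^ 2 / ‖α‖ ^ 2 := by
      rw [← real_inner_self_eq_norm_sq (pr α y)]
      nth_rw 1 [pr]
      rw [inner_sub_left, inner_smul_left, inner_pr, pr, inner_sub_right, inner_smul_right,
        real_inner_self_eq_norm_sq, real_inner_comm α y]
      simp; ring
    rw [e]; field_simp

lemma norm_pr_le : ‖pr α y‖ ≤ ‖y‖ := by
  by_cases h : α = 0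
  · simp [h, pr]
  · have h0 : 0 < ‖α‖ := norm_pos_iff.2 h
    have := norm_pr_sq α y
    apply le_of_sq_le_sq _ (norm_nonneg _)
    have h2 : 0 < ‖α‖ ^ 2 := by positivity
    by_contra hc
    push Not at hc
    nlinarith [sq_nonneg ⟪α, y⟫]

lemma inner_pr_pr : ⟪pr α x, pr α y⟫ = ⟪pr α x, y⟫ := by
  nth_rw 2 [pr]
  rw [inner_sub_right, inner_smul_right, real_inner_comm α (pr α x), inner_pr]; simp
end prlemmas

/-- coefficient in the midpoint -/
def midT {n : ℕ} (α β h : V n) : ℝ :=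
  (‖α‖ ^ 2 * ⟪h, β⟫ + ⟪α, β⟫ * ⟪h, α⟫) / (2 * (‖α‖ ^ 2 * ‖β‖ ^ 2 - ⟪α, β⟫ ^ 2))

def mid {n : ℕ} (a c v w : V n) : V n :=
  (2:ℝ)⁻¹ • (v + w) + (midT (w - c) (v - a) (v - w) • (v - a) +
    midT (v - a) (w - c) (w - v) • (w - c))

lemma mid_symm {n : ℕ} (a c v w : V n) : mid c a w v = mid a c v w := by
  unfold mid
  rw [add_comm w v, add_comm (midT _ _ _ • _)]

lemma mid_facts {n : ℕ} (a c v w : V n) (h0 : pr (v - a) (w - c) ≠ 0) (ha : v - a ≠ 0) :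
    ⟪v - a, mid a c v w - v⟫ = 0 ∧ ⟪mid a c v w - v, w - c⟫ = ⟪w - v, w - c⟫ ∧
    mid a c v w - v = (2:ℝ)⁻¹ • pr (v - a) (w - v) +
      midT (v - a) (w - c) (w - v) • pr (v - a) (w - c) := by
  set t2 := midT (v - a) (w - c) (w - v) with ht2
  set t1 := midT (w - c) (v - a) (v - w) with ht1
  have hm : mid a c v w - v = (2:ℝ)⁻¹ • (w - v) + (t1 • (v - a) + t2 • (w - c)) := by
    unfold mid; module
  rw [hm]
  have hvw : v - w = - (w - v) := by abel
  rw [hvw] at ht1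
  clear hm hvw
  generalize v - a = α at *
  generalize w - c = β at *
  generalize w - v = h at *
  have hG := norm_pr_sq α β
  set G := ‖α‖ ^ 2 * ‖β‖ ^ 2 - ⟪α, β⟫ ^ 2 with hGd
  have hG0 : 0 < G := by
    have := norm_pos_iff.2 h0
    have := norm_pos_iff.2 ha
    rw [← hG]; positivity
  have t2e : t2 * (2 * G) = ‖α‖ ^ 2 * ⟪h, β⟫ + ⟪α, β⟫ * ⟪h, α⟫ := by
    rw [ht2, midT, ← hGd]; field_simp
  have t1e : t1 * (2 * G) = - (‖β‖ ^ 2 * ⟪h, α⟫ + ⟪α, β⟫ * ⟪h, β⟫) := by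
    rw [ht1, midT, real_inner_comm α β, inner_neg_left, inner_neg_left,
      show ‖β‖ ^ 2 * ‖α‖ ^ 2 - ⟪α, β⟫ ^ 2 = G by rw [hGd]; ring]
    field_simp; ring
  have f1 : ⟪α, (2:ℝ)⁻¹ • h + (t1 • α + t2 • β)⟫ = 0 := by
    rw [inner_add_right, inner_add_right, inner_smul_right, inner_smul_right, inner_smul_right,
      real_inner_self_eq_norm_sq, real_inner_comm h α]
    have : 2 * G * (2⁻¹ * ⟪h, α⟫ + (t1 * ‖α‖ ^ 2 + t2 * ⟪α, β⟫)) = 0 := by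
      linear_combination ‖α‖ ^ 2 * t1e + ⟪α, β⟫ * t2e + ⟪h, α⟫ * hGd
    have h2 : 2 * G ≠ 0 := by positivity
    exact (mul_eq_zero.1 this).resolve_left h2
  refine ⟨f1, ?_, ?_⟩
  · rw [inner_add_left, inner_add_left, inner_smul_left, inner_smul_left, inner_smul_left,
      real_inner_self_eq_norm_sq]
    simp only [conj_trivial]
    have : 2 * G * (2⁻¹ * ⟪h, β⟫ + (t1 * ⟪α, β⟫ + t2 * ‖β‖ ^ 2) - ⟪h, β⟫) = 0 := by
      linear_combination ⟪α, β⟫ * t1e + ‖β‖ ^ 2 * t2e - ⟪h, β⟫ * hGd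
    have h2 : 2 * G ≠ 0 := by positivity
    linarith [(mul_eq_zero.1 this).resolve_left h2]
  · rw [← pr_of_inner _ _ f1, pr_add, pr_add, pr_smul, pr_smul, pr_smul, pr_self]
    simp

/-- the vector orthogonal to `β0` in the plane spanned by `α`, `β0`. -/
def zet {n : ℕ} (e κ : V n) (l : ℝ) : V n :=
  (√(l ^ 2 + ‖κ‖ ^ 2) * ‖κ‖)⁻¹ • (l • κ - ‖κ‖ ^ 2 • e)

lemma norm_zet {n : ℕ} (e κ : V n) (l : ℝ) (he : ‖e‖ = 1) (hk : ⟪e, κ⟫ = 0) (h0 : 0 < ‖κ‖) :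
    ‖zet e κ l‖ = 1 := by
  have h1 : ‖l • κ - ‖κ‖ ^ 2 • e‖ ^ 2 = (√(l ^ 2 + ‖κ‖ ^ 2) * ‖κ‖) ^ 2 := by
    rw [mul_pow, Real.sq_sqrt (by positivity), norm_sub_sq_real, norm_smul, norm_smul,
      inner_smul_left, inner_smul_right, real_inner_comm, hk, he, mul_pow, mul_pow,
      Real.norm_eq_abs, Real.norm_eq_abs, sq_abs, sq_abs]
    simp; ring
  have h2 : 0 < √(l ^ 2 + ‖κ‖ ^ 2) * ‖κ‖ := by positivity
  have h3 : ‖l • κ - ‖κ‖ ^ 2 • e‖ = √(l ^ 2 + ‖κ‖ ^ 2) * ‖κ‖ := by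
    rwa [sq_eq_sq₀ (norm_nonneg _) h2.le] at h1
  rw [zet, norm_smul, h3, norm_inv, Real.norm_eq_abs, abs_of_pos h2, inv_mul_cancel₀ h2.ne']

lemma decomp {n : ℕ} (e κ Δ : V n) (l ρ : ℝ) (he : ‖e‖ = 1) (hk : ⟪e, κ⟫ = 0) (hρ : 0 < ρ)
    (hκ : ρ ≤ ‖κ‖) :
    ‖Δ‖ ≤ |⟪Δ, l • e + κ⟫| / ρ + |⟪Δ, zet e κ l⟫| + ‖pr κ (Δ - ⟪Δ, e⟫ • e)‖ := by
  have h0 : 0 < ‖κ‖ := by linarith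
  set N := √(l ^ 2 + ‖κ‖ ^ 2) with hN
  have hN0 : 0 < N := by positivity
  have hN2 : N ^ 2 = l ^ 2 + ‖κ‖ ^ 2 := Real.sq_sqrt (by positivity)
  have hNρ : ρ ≤ N := by
    apply le_of_sq_le_sq _ hN0.le
    rw [hN2]; nlinarith [sq_nonneg l]
  have hβn : ‖l • e + κ‖ = N := by
    have : ‖l • e + κ‖ ^ 2 = N ^ 2 := by
      rw [hN2, norm_add_sq_real, norm_smul, inner_smul_left, hk, he, mul_pow, Real.norm_eq_abs, sq_abs]
      simp
    rwa [sq_eq_sq₀ (norm_nonneg _) hN0.le] at this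
  have id : Δ = (⟪Δ, l • e + κ⟫ / N ^ 2) • (l • e + κ) + ⟪Δ, zet e κ l⟫ • zet e κ l +
      pr κ (Δ - ⟪Δ, e⟫ • e) := by
    have e1 : ⟪κ, Δ - ⟪Δ, e⟫ • e⟫ = ⟪Δ, κ⟫ := by
      rw [inner_sub_right, inner_smul_right, real_inner_comm e κ, hk, real_inner_comm]; simp
    rw [pr, e1, zet, ← hN]
    simp only [inner_add_right, inner_smul_right, inner_sub_right]
    have hN2' : ‖κ‖ ^ 2 = N ^ 2 - l ^ 2 := by linarith
    match_scalars
    · field_simp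
    · field_simp
      ring_nf
      have : ‖κ‖ ^ 4 = (‖κ‖ ^ 2) ^ 2 := by ring
      rw [hN2']; ring
    · field_simp
      rw [hN2']; ring
  calc ‖Δ‖ = ‖(⟪Δ, l • e + κ⟫ / N ^ 2) • (l • e + κ) + ⟪Δ, zet e κ l⟫ • zet e κ l +
      pr κ (Δ - ⟪Δ, e⟫ • e)‖ := by rw [← id]
    _ ≤ ‖(⟪Δ, l • e + κ⟫ / N ^ 2) • (l • e + κ)‖ + ‖⟪Δ, zet e κ l⟫ • zet e κ l‖ +
      ‖pr κ (Δ - ⟪Δ, e⟫ • e)‖ := norm_add₃_le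
    _ ≤ _ := by
      rw [norm_smul, norm_smul, hβn, norm_zet e κ l he hk h0, Real.norm_eq_abs, Real.norm_eq_abs,
        abs_div, mul_one, abs_of_pos (by positivity : 0 < N ^ 2)]
      gcongr
      rw [show |⟪Δ, l • e + κ⟫| / N ^ 2 * N = |⟪Δ, l • e + κ⟫| / N by field_simp]
      gcongr

set_option maxHeartbeats 1000000 in
lemma expand_core {n : ℕ} (e κ : V n) (l ρ K Cp ε : ℝ) (he : ‖e‖ = 1) (hk : ⟪e, κ⟫ = 0)
    (hρ : 0 < ρ) (hκ : ρ ≤ ‖κ‖) (hκK : ‖κ‖ ≤ K) (hε : 0 < ε) (hε1 : ε ≤ 1) (hCp : 0 ≤ Cp)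
    (hε2 : ε * (2 * (Cp + 10)) ≤ ρ)
    (h1 h2 η1 η2 p1 p2 : V n) (t1 t2 : ℝ)
    (hη1 : η1 = h1 - ⟪h1, e⟫ • e) (hη2 : η2 = h2 - ⟪h2, e⟫ • e)
    (hp1 : p1 = (2:ℝ)⁻¹ • η1 + t1 • (κ + η1)) (hp2 : p2 = (2:ℝ)⁻¹ • η2 + t2 • (κ + η2))
    (hq1 : ⟪p1, κ + η1⟫ = ⟪h1, l • e + κ⟫ + ‖h1‖ ^ 2)
    (hq2 : ⟪p2, κ + η2⟫ = ⟪h2, l • e + κ⟫ + ‖h2‖ ^ 2)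
    (hh1 : ‖h1‖ ≤ ε) (hh2 : ‖h2‖ ≤ ε) (hpp2 : ‖p2‖ ≤ Cp * ε)
    (hlow2 : ρ ≤ ‖κ + η2‖) (ht1 : |t1| ≤ 1 / 4) (D : ℝ)
    (hD : D = ‖(p1 + ⟪h1, zet e κ l⟫ • e) - (p2 + ⟪h2, zet e κ l⟫ • e)‖)
    (hpe1 : ⟪e, p1⟫ = 0) (hpe2 : ⟪e, p2⟫ = 0) :
    ‖h1 - h2‖ ≤ (2 * ((K + 1) / ρ + 6)) * D ∧
    |⟪h1 - h2, l • e + κ⟫| ≤ ((K + 1) + ρ * (2 * ((K + 1) / ρ + 6))) * D := by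
  have hκ0 : 0 < ‖κ‖ := by linarith
  have hK : 0 < K := by linarith
  have hee : ⟪e, e⟫ = 1 := by rw [real_inner_self_eq_norm_sq, he]; norm_num
  set Δ := h1 - h2 with hΔ
  have hηl : ∀ x : V n, ‖x - ⟪x, e⟫ • e‖ ≤ ‖x‖ := by
    intro x
    have := norm_pr_le e x
    rwa [pr, he, real_inner_comm, one_pow, div_one] at this
  have hΔη : η1 - η2 = Δ - ⟪Δ, e⟫ • e := by
    rw [hη1, hη2, hΔ, inner_sub_left]; module
  have hη1n : ‖η1‖ ≤ ε := by rw [hη1]; exact (hηl _).trans hh1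
  have hη2n : ‖η2‖ ≤ ε := by rw [hη2]; exact (hηl _).trans hh2
  have hΔηn : ‖η1 - η2‖ ≤ ‖Δ‖ := by rw [hΔη]; exact hηl _
  have hDn : (p1 + ⟪h1, zet e κ l⟫ • e) - (p2 + ⟪h2, zet e κ l⟫ • e) =
      (p1 - p2) + ⟪Δ, zet e κ l⟫ • e := by rw [hΔ, inner_sub_left]; module
  have hD2 : D ^ 2 = ‖p1 - p2‖ ^ 2 + |⟪Δ, zet e κ l⟫| ^ 2 := by
    rw [hD, hDn, norm_add_sq_real, inner_smul_right, real_inner_comm e (p1 - p2), inner_sub_right, hpe1, hpe2,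
      norm_smul, he, Real.norm_eq_abs]
    ring
  have hD0 : 0 ≤ D := by rw [hD]; exact norm_nonneg _
  have hP : ‖p1 - p2‖ ≤ D := by
    apply le_of_sq_le_sq _ hD0
    nlinarith [sq_nonneg |⟪Δ, zet e κ l⟫|]
  have hX : |⟪Δ, zet e κ l⟫| ≤ D := by
    apply le_of_sq_le_sq _ hD0
    nlinarith [sq_nonneg ‖p1 - p2‖]
  set N := ‖Δ‖ with hNd
  have hN0 : 0 ≤ N := norm_nonneg _
  set U := |⟪Δ, l • e + κ⟫| with hU
  have hU1 : U ≤ (K + 1) * D + (Cp + 2) * ε * N := by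
    have id : ⟪Δ, l • e + κ⟫ = ⟪p1 - p2, κ + η1⟫ + ⟪p2, η1 - η2⟫ - ⟪h1 + h2, Δ⟫ := by
      have e1 : ⟪h1 + h2, Δ⟫ = ‖h1‖ ^ 2 - ‖h2‖ ^ 2 := by
        rw [hΔ, inner_add_left, inner_sub_right, inner_sub_right, real_inner_self_eq_norm_sq,
          real_inner_self_eq_norm_sq, real_inner_comm h1 h2]; ring
      have e2 : ⟪p1 - p2, κ + η1⟫ + ⟪p2, η1 - η2⟫ = ⟪p1, κ + η1⟫ - ⟪p2, κ + η2⟫ := by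
        simp only [inner_sub_left, inner_add_right, inner_sub_right]; ring
      rw [e1, e2, hq1, hq2, hΔ, inner_sub_left]; ring
    have b1 : |⟪p1 - p2, κ + η1⟫| ≤ D * (K + 1) :=
      (abs_real_inner_le_norm _ _).trans (mul_le_mul hP ((norm_add_le _ _).trans (by linarith))
        (norm_nonneg _) hD0)
    have b2 : |⟪p2, η1 - η2⟫| ≤ (Cp * ε) * N :=
      (abs_real_inner_le_norm _ _).trans (mul_le_mul hpp2 hΔηn (norm_nonneg _) (by positivity))
    have b3 : |⟪h1 + h2, Δ⟫| ≤ (2 * ε) * N :=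
      (abs_real_inner_le_norm _ _).trans (mul_le_mul_of_nonneg_right
        ((norm_add_le _ _).trans (by linarith)) hN0)
    rw [hU, id]
    rw [abs_le] at b1 b2 b3 ⊢
    constructor <;> linarith [b1.1, b1.2, b2.1, b2.2, b3.1, b3.2]
  have hdp : p1 - p2 = (2⁻¹ + t1) • (η1 - η2) + (t1 - t2) • (κ + η2) := by
    rw [hp1, hp2]; module
  have ht1' := abs_le.1 ht1
  set T := |t1 - t2| with hT
  have hT0 : 0 ≤ T := abs_nonneg _
  have hT1 : ρ * T ≤ D + N := by
    have : (t1 - t2) • (κ + η2) = (p1 - p2) - (2⁻¹ + t1) • (η1 - η2) := by rw [hdp]; abel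
    have h3 : ‖(t1 - t2) • (κ + η2)‖ ≤ D + N := by
      rw [this]
      refine (norm_sub_le _ _).trans (add_le_add hP ?_)
      rw [norm_smul, Real.norm_eq_abs, abs_of_pos (by linarith)]
      refine le_trans (mul_le_of_le_one_left (norm_nonneg _) (by linarith)) hΔηn
    rw [norm_smul, Real.norm_eq_abs] at h3
    have h4 := mul_le_mul_of_nonneg_left hlow2 hT0
    linarith
  set Q := ‖pr κ (η1 - η2)‖ with hQ
  have hQ1 : Q ≤ 4 * (D + ε * T) := by
    have h3 : (2⁻¹ + t1) • pr κ (η1 - η2) = pr κ (p1 - p2) - (t1 - t2) • pr κ η2 := by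
      rw [hdp, pr_add, pr_smul, pr_smul, pr_add, pr_self, zero_add]; abel
    have h4 : ‖(2⁻¹ + t1) • pr κ (η1 - η2)‖ ≤ D + T * ε := by
      rw [h3]
      refine (norm_sub_le _ _).trans (add_le_add ((norm_pr_le _ _).trans hP) ?_)
      rw [norm_smul, Real.norm_eq_abs]
      exact mul_le_mul_of_nonneg_left ((norm_pr_le _ _).trans hη2n) hT0
    rw [norm_smul, Real.norm_eq_abs, abs_of_pos (by linarith)] at h4
    have hQ0 : 0 ≤ Q := norm_nonneg _
    have h5 : (1 / 4) * Q ≤ (2⁻¹ + t1) * Q := mul_le_mul_of_nonneg_right (by linarith) hQ0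
    linarith
  have hN1 : N ≤ U / ρ + D + Q := by
    have := decomp e κ Δ l ρ he hk hρ hκ
    rw [← hΔη] at this
    linarith
  have hN2 : ρ * N ≤ U + ρ * D + ρ * Q := by
    have := mul_le_mul_of_nonneg_left hN1 hρ.le
    rwa [mul_add, mul_add, mul_div_cancel₀ _ hρ.ne'] at this
  have hρQ : ρ * Q ≤ 4 * ρ * D + 4 * ε * (D + N) := by
    linarith [mul_le_mul_of_nonneg_left hQ1 hρ.le, mul_le_mul_of_nonneg_left hT1 hε.le]
  have hN3 : ρ * N ≤ 2 * ((K + 1) + 6 * ρ) * D := by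
    have h5 : ε * (2 * (Cp + 10)) * N ≤ ρ * N := mul_le_mul_of_nonneg_right hε2 hN0
    have h7 : 0 ≤ ε * Cp := by positivity
    have h6 : 4 * ε * D ≤ ρ * D := mul_le_mul_of_nonneg_right (by linarith) hD0
    linarith [mul_nonneg hε.le hN0]
  have hN4 : N ≤ (2 * ((K + 1) / ρ + 6)) * D := by
    rw [show (2 * ((K + 1) / ρ + 6)) * D = (2 * ((K + 1) + 6 * ρ) * D) / ρ by field_simp,
      le_div_iff₀ hρ]
    linarith
  refine ⟨hN4, ?_⟩
  have : (Cp + 2) * ε * N ≤ ρ * ((2 * ((K + 1) / ρ + 6)) * D) := by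
    have : (Cp + 2) * ε ≤ ρ := by
      have h7 : 0 ≤ ε * Cp := by positivity
      linarith
    exact mul_le_mul this hN4 hN0 hρ.le
  linarith

end

noncomputable section

def good {n : ℕ} (δ : ℝ) (a c v w : V n) : Prop :=
  δ ≤ ‖pr (v - a) (w - c)‖ ∧ δ ≤ ‖pr (w - c) (v - a)‖

lemma good_symm {n : ℕ} (δ : ℝ) (a c v w : V n) : good δ c a w v ↔ good δ a c v w := and_comm

lemma anisoDist_symm {n : ℕ} (v w : V n) : anisoDist w v = anisoDist v w := by
  unfold anisoDist
  rw [norm_sub_rev]; congr 2; ring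

lemma norm_le_anisoDist {n : ℕ} (v w : V n) : ‖w - v‖ ≤ anisoDist v w := by
  unfold anisoDist
  apply Real.le_sqrt_of_sq_le
  rw [norm_sub_rev]
  nlinarith [sq_nonneg (‖v‖ ^ 2 - ‖w‖ ^ 2)]

lemma abs_le_anisoDist {n : ℕ} (v w : V n) : |‖w‖ ^ 2 - ‖v‖ ^ 2| ≤ 2 * anisoDist v w := by
  unfold anisoDist
  have : |‖w‖ ^ 2 - ‖v‖ ^ 2| / 2 ≤ √(‖v - w‖ ^ 2 + 4⁻¹ * (‖v‖ ^ 2 - ‖w‖ ^ 2) ^ 2) := by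
    apply Real.le_sqrt_of_sq_le
    rw [div_pow, sq_abs]
    nlinarith [sq_nonneg ‖v - w‖]
  linarith

lemma anisoDist_nonneg {n : ℕ} (v w : V n) : 0 ≤ anisoDist v w := Real.sqrt_nonneg _

lemma jap_pos {n : ℕ} (v : V n) : 0 < jap v := by unfold jap; positivity

lemma jap_le {n : ℕ} (v : V n) : jap v ≤ 1 + ‖v‖ := by
  unfold jap
  apply Real.sqrt_le_iff.2
  constructor
  · positivity
  · nlinarith [norm_nonneg v]

lemma measurable_anisoDist {n : ℕ} : Measurable (fun p : V n × V n => anisoDist p.1 p.2) := by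
  unfold anisoDist; fun_prop

lemma measurable_jap {n : ℕ} : Measurable (fun p : V n => jap p) := by
  unfold jap; fun_prop

lemma measurable_midT {n : ℕ} : Measurable (fun p : V n × V n × V n => midT p.1 p.2.1 p.2.2) := by
  unfold midT; fun_prop

lemma measurable_mid {n : ℕ} :
    Measurable (fun p : V n × V n × V n × V n => mid p.1 p.2.1 p.2.2.1 p.2.2.2) := by
  unfold mid midT; fun_prop

lemma measurableSet_good {n : ℕ} (δ : ℝ) :
    MeasurableSet {p : V n × V n × V n × V n | good δ p.1 p.2.1 p.2.2.1 p.2.2.2} := by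
  unfold good pr
  refine measurableSet_and' (measurableSet_le ?_ ?_) (measurableSet_le ?_ ?_) <;> fun_prop

/-- all facts about the midpoint displacement -/
lemma mid_size {n : ℕ} (R δ ε : ℝ) (hR : 0 < R) (hδ : 0 < δ) (hε1 : ε ≤ 1)
    (a c v w : V n) (ha : ‖a‖ ≤ R) (hc : ‖c‖ ≤ R) (hg : good δ a c v w) (hd : anisoDist v w ≤ ε)
    (Ct Cp : ℝ) (hCt : Ct = (3 + R) / δ ^ 2 + 1 / (2 * δ)) (hCp : Cp = 1 / 2 + Ct * (2 * R + 1))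
    (hεt : Ct * ε ≤ 1 / 4) (e κ η : V n) (l t : ℝ) (he : e = ‖v - a‖⁻¹ • (v - a))
    (hκ : κ = pr (v - a) (v - c)) (hl : l = ⟪v - c, e⟫) (hη : η = pr (v - a) (w - v))
    (ht : t = midT (v - a) (w - c) (w - v)) :
    ‖e‖ = 1 ∧ ⟪e, κ⟫ = 0 ∧ v - c = l • e + κ ∧ ‖κ‖ ≤ 2 * R ∧ δ - ε ≤ ‖κ‖ ∧ δ ≤ ‖v - a‖ ∧
    η = (w - v) - ⟪w - v, e⟫ • e ∧ mid a c v w - v = (2:ℝ)⁻¹ • η + t • (κ + η) ∧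
    ⟪mid a c v w - v, κ + η⟫ = ⟪w - v, l • e + κ⟫ + ‖w - v‖ ^ 2 ∧
    ‖mid a c v w - v‖ ≤ Cp * anisoDist v w ∧ δ ≤ ‖κ + η‖ ∧ |t| ≤ 1 / 4 ∧
    ⟪e, mid a c v w - v⟫ = 0 := by
  set d := anisoDist v w with hdd
  have hd0 : 0 ≤ d := anisoDist_nonneg _ _
  have hα : δ ≤ ‖v - a‖ := hg.2.trans (norm_pr_le _ _)
  have hα0 : 0 < ‖v - a‖ := by linarith
  have hαn : v - a ≠ 0 := norm_pos_iff.1 hα0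
  have hz : κ + η = pr (v - a) (w - c) := by
    rw [hκ, hη, ← pr_add]; congr 1; abel
  have hzδ : δ ≤ ‖κ + η‖ := by rw [hz]; exact hg.1
  have hz0 : pr (v - a) (w - c) ≠ 0 := by
    rw [← norm_pos_iff, ← hz]; linarith
  obtain ⟨m1, m2, m3⟩ := mid_facts a c v w hz0 hαn
  have he1 : ‖e‖ = 1 := by rw [he]; exact norm_smul_inv_norm (𝕜 := ℝ) hαn
  have hpre : ∀ x, pr (v - a) x = x - ⟪x, e⟫ • e := by
    intro x
    rw [pr, he, inner_smul_right, smul_smul, real_inner_comm (v - a) x]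
    congr 2
    field_simp
  have heo : ∀ x, ⟪v - a, x⟫ = 0 → ⟪e, x⟫ = 0 := by
    intro x hx; rw [he, inner_smul_left, hx, mul_zero]
  have hβ0 : v - c = l • e + κ := by rw [hκ, hpre, hl]; abel
  have hκR : ‖κ‖ ≤ 2 * R := by
    have : κ = pr (v - a) (a - c) := by
      rw [hκ, show v - c = (v - a) + (a - c) by abel, pr_add, pr_self, zero_add]
    rw [this]
    exact (norm_pr_le _ _).trans ((norm_sub_le _ _).trans (by linarith))
  have hhd : ‖w - v‖ ≤ d := norm_le_anisoDist v w
  have hηd : ‖η‖ ≤ d := by rw [hη]; exact (norm_pr_le _ _).trans hhd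
  have hκl : δ - ε ≤ ‖κ‖ := by
    have := norm_add_le κ η
    linarith
  have hp : mid a c v w - v = (2:ℝ)⁻¹ • η + t • (κ + η) := by rw [hz, hη, ht]; exact m3
  have hpi : ⟪mid a c v w - v, κ + η⟫ = ⟪w - v, w - c⟫ := by
    rw [← m2, hz]
    nth_rw 1 [← pr_of_inner _ _ m1]
    rw [inner_pr_pr, pr_of_inner _ _ m1]
  have hsum : ⟪w - v, w - c⟫ = ⟪w - v, l • e + κ⟫ + ‖w - v‖ ^ 2 := by
    rw [← hβ0, ← real_inner_self_eq_norm_sq, ← inner_add_right]; congr 1; abel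
  have hu : |⟪w - v, w - c⟫| ≤ (3 + R) * d := by
    have e1 : ⟪w - v, w - c⟫ = (‖w‖ ^ 2 - ‖v‖ ^ 2) / 2 + ‖w - v‖ ^ 2 / 2 - ⟪w - v, c⟫ := by
      rw [← real_inner_self_eq_norm_sq w, ← real_inner_self_eq_norm_sq v,
        ← real_inner_self_eq_norm_sq (w - v)]
      simp only [inner_sub_left, inner_sub_right]
      rw [real_inner_comm v w]; ring
    have e2 := abs_le_anisoDist v w
    rw [← hdd] at e2
    have e3 : |⟪w - v, c⟫| ≤ d * R :=
      (abs_real_inner_le_norm _ _).trans (mul_le_mul hhd hc (norm_nonneg _) hd0)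
    have e4 : ‖w - v‖ ^ 2 ≤ d := by
      have : ‖w - v‖ ^ 2 ≤ d * 1 := by
        rw [sq]; exact mul_le_mul hhd (by linarith) (norm_nonneg _) hd0
      linarith
    have e5 := sq_nonneg ‖w - v‖
    rw [e1]
    rw [abs_le] at e2 e3 ⊢
    constructor <;> linarith [e2.1, e2.2, e3.1, e3.2]
  set z := ‖κ + η‖ with hzd
  have hz1 : 0 < z := by linarith
  have htd : |t| ≤ Ct * d := by
    have e1 : t * z ^ 2 = ⟪w - v, w - c⟫ - 2⁻¹ * ⟪η, κ + η⟫ := by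
      rw [← hpi, hp, inner_add_left, inner_smul_left, inner_smul_left,
        real_inner_self_eq_norm_sq, ← hzd]; simp
    have e2 : |⟪η, κ + η⟫| ≤ d * z :=
      (abs_real_inner_le_norm _ _).trans (mul_le_mul_of_nonneg_right hηd (norm_nonneg _))
    have e3 : |t| * z ^ 2 ≤ (3 + R) * d + d * z / 2 := by
      rw [← abs_of_pos (by positivity : 0 < z ^ 2), ← abs_mul, e1]
      rw [abs_le] at hu e2 ⊢
      constructor <;> linarith [hu.1, hu.2, e2.1, e2.2]
    have e4 : |t| ≤ ((3 + R) * d + d * z / 2) / z ^ 2 := (le_div_iff₀ (by positivity)).2 e3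
    have e5 : ((3 + R) * d + d * z / 2) / z ^ 2 = ((3 + R) / z ^ 2 + 1 / (2 * z)) * d := by
      field_simp
    rw [e5] at e4
    refine e4.trans ?_
    rw [hCt]
    gcongr
  have hCt0 : 0 ≤ Ct := by rw [hCt]; positivity
  have ht4 : |t| ≤ 1 / 4 := htd.trans ((mul_le_mul_of_nonneg_left hd hCt0).trans hεt)
  refine ⟨he1, ?_, hβ0, hκR, hκl, hα, by rw [hη, hpre], hp, by rw [hpi, hsum], ?_, hzδ, ht4,
    heo _ m1⟩
  · rw [hκ]; exact heo _ (inner_pr _ _)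
  · rw [hp, hCp]
    refine (norm_add_le _ _).trans ?_
    rw [norm_smul, norm_smul, Real.norm_eq_abs, Real.norm_eq_abs, abs_of_pos (by norm_num : (0:ℝ) < 2⁻¹)]
    have hzu : ‖κ + η‖ ≤ 2 * R + 1 := (norm_add_le _ _).trans (by linarith)
    have := mul_le_mul htd hzu (norm_nonneg _) (by positivity)
    linarith

/-- the linear comparison map -/
def cmpA {n : ℕ} (β : V n) : V n →ₗ[ℝ] V n :=
  LinearMap.transvection (innerₗ (V n) β) (((‖β‖ - 1) / ‖β‖ ^ 2) • β)

lemma det_cmpA {n : ℕ} (β : V n) (hβ : β ≠ 0) : (cmpA β).det = ‖β‖ := by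
  have : ‖β‖ ≠ 0 := norm_ne_zero_iff.2 hβ
  rw [cmpA, LinearMap.transvection.det, innerₗ_apply_apply, inner_smul_right,
    real_inner_self_eq_norm_sq]
  field_simp; ring

lemma norm_cmpA {n : ℕ} (β x : V n) (ρ : ℝ) (hρ : 0 < ρ) (hβ : ρ ≤ ‖β‖) :
    ‖cmpA β x‖ ≤ ‖x‖ + (1 + 1 / ρ) * |⟪x, β⟫| := by
  have h0 : 0 < ‖β‖ := by linarith
  rw [cmpA, LinearMap.transvection.apply, innerₗ_apply_apply]
  refine (norm_add_le _ _).trans ?_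
  gcongr
  rw [norm_smul, norm_smul, real_inner_comm, mul_comm, Real.norm_eq_abs, Real.norm_eq_abs]
  gcongr
  rw [abs_div, abs_of_pos (by positivity : 0 < ‖β‖ ^ 2)]
  rw [show |‖β‖ - 1| / ‖β‖ ^ 2 * ‖β‖ = |‖β‖ - 1| / ‖β‖ by field_simp, div_le_iff₀ h0]
  have : 1 ≤ 1 / ρ * ‖β‖ := by
    rw [one_div, inv_mul_eq_div, le_div_iff₀ hρ]; linarith
  rw [abs_le]
  constructor <;> nlinarith
end

noncomputable section

set_option maxHeartbeats 1000000 in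
lemma first_term (n : ℕ) (q R δ : ℝ) (hq : 0 < q) (hR : 0 < R) (hδ : 0 < δ) :
    ∃ ε C : ℝ, 0 < ε ∧ ε ≤ 1 ∧ 0 < C ∧ ∀ a c v : V n, ‖a‖ ≤ R → ‖c‖ ≤ R →
      ∀ Φ : V n → ℝ≥0∞, Measurable Φ →
      ∫⁻ w, (open Classical in if anisoDist v w ≤ ε ∧ good δ a c v w then
          ENNReal.ofReal (anisoDist v w ^ (-q)) * Φ (mid a c v w) else 0) ≤
        ENNReal.ofReal (C / jap v) * ∫⁻ y, (if ‖y‖ ≤ ‖v - a‖ then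
          ENNReal.ofReal (‖y‖ ^ (-q)) * Φ (v + pr (v - a) y) else 0) := by
  classical
  obtain ⟨Ct, hCt⟩ : ∃ Ct, Ct = (3 + R) / δ ^ 2 + 1 / (2 * δ) := ⟨_, rfl⟩
  obtain ⟨Cp, hCp⟩ : ∃ Cp, Cp = 1 / 2 + Ct * (2 * R + 1) := ⟨_, rfl⟩
  have hCt0 : 0 < Ct := by rw [hCt]; positivity
  have hCp0 : 0 < Cp := by rw [hCp]; positivity
  obtain ⟨ρ, hρd⟩ : ∃ ρ, ρ = δ / 2 := ⟨_, rfl⟩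
  have hρ : 0 < ρ := by rw [hρd]; positivity
  obtain ⟨ε, hεd⟩ : ∃ ε, ε = min 1 (min (ρ / (2 * (Cp + 10))) (1 / (4 * Ct))) := ⟨_, rfl⟩
  have hε : 0 < ε := by rw [hεd]; positivity
  have hε1 : ε ≤ 1 := by rw [hεd]; exact min_le_left _ _
  have hε2 : ε * (2 * (Cp + 10)) ≤ ρ := by
    rw [← le_div_iff₀ (by positivity), hεd]
    exact (min_le_right _ _).trans (min_le_left _ _)
  have hε3 : Ct * ε ≤ 1 / 4 := by
    have : ε ≤ 1 / (4 * Ct) := by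
      rw [hεd]; exact (min_le_right _ _).trans (min_le_right _ _)
    rw [le_div_iff₀ (by positivity)] at this
    linarith
  have hεCp : 0 < ε * Cp := by positivity
  obtain ⟨C1, hC1⟩ : ∃ C1, C1 = 2 * ((2 * R + 1) / ρ + 6) := ⟨_, rfl⟩
  obtain ⟨C2, hC2⟩ : ∃ C2, C2 = (2 * R + 1) + ρ * C1 := ⟨_, rfl⟩
  obtain ⟨CE, hCE⟩ : ∃ CE, CE = C1 + (1 + 1 / ρ) * C2 := ⟨_, rfl⟩
  have hC10 : 0 < C1 := by rw [hC1]; positivity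
  have hC20 : 0 < C2 := by rw [hC2]; positivity
  have hCE0 : 0 < CE := by rw [hCE]; positivity
  obtain ⟨CJ, hCJ⟩ : ∃ CJ, CJ = (1 + R) / ρ + 1 := ⟨_, rfl⟩
  have hCJ0 : 0 < CJ := by rw [hCJ]; positivity
  refine ⟨ε, CJ * CE ^ n * (Cp + 1) ^ q, hε, hε1, by positivity, ?_⟩
  intro a c v ha hc Φ hΦ
  by_cases hex : ∃ w, anisoDist v w ≤ ε ∧ good δ a c v w
  swap
  · have : ∀ w, ¬ (anisoDist v w ≤ ε ∧ good δ a c v w) := fun w hw => hex ⟨w, hw⟩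
    simp [this]
  obtain ⟨e, he⟩ : ∃ e, e = ‖v - a‖⁻¹ • (v - a) := ⟨_, rfl⟩
  obtain ⟨κ, hκ⟩ : ∃ κ, κ = pr (v - a) (v - c) := ⟨_, rfl⟩
  obtain ⟨l, hl⟩ : ∃ l, l = ⟪v - c, e⟫ := ⟨_, rfl⟩
  have hsize : ∀ w, anisoDist v w ≤ ε ∧ good δ a c v w → _ := fun w hw =>
    mid_size R δ ε hR hδ hε1 a c v w ha hc hw.2 hw.1 Ct Cp hCt hCp hε3 e κ
      (pr (v - a) (w - v)) l (midT (v - a) (w - c) (w - v)) he hκ hl rfl rfl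
  obtain ⟨he1, heκ, hβ0, hκR, hκl, hα⟩ : ‖e‖ = 1 ∧ ⟪e, κ⟫ = 0 ∧ v - c = l • e + κ ∧
      ‖κ‖ ≤ 2 * R ∧ δ - ε ≤ ‖κ‖ ∧ δ ≤ ‖v - a‖ := by
    obtain ⟨w, hw⟩ := hex
    obtain ⟨g1, g2, g3, g4, g5, g6, -⟩ := hsize w hw
    exact ⟨g1, g2, g3, g4, g5, g6⟩
  have hρκ : ρ ≤ ‖κ‖ := by linarith
  have hρβ : ρ ≤ ‖v - c‖ := hρκ.trans (by rw [hκ]; exact norm_pr_le _ _)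
  have hβ0n : v - c ≠ 0 := by rw [← norm_pos_iff]; linarith
  have hz1 : ‖zet e κ l‖ = 1 := norm_zet e κ l he1 heκ (by linarith)
  have hpre : pr (v - a) e = 0 := by rw [he, pr_smul, pr_self, smul_zero]
  have hαe : ∀ x, ⟪e, x⟫ = 0 → ⟪v - a, x⟫ = 0 := by
    intro x hx
    have h0 : ‖v - a‖ ≠ 0 := by linarith
    rw [he, inner_smul_left] at hx
    simpa [h0] using hx
  let Ψ : V n → V n := fun h => (mid a c v (v + h) - v) + ⟪h, zet e κ l⟫ • e
  have hm2 : Measurable (fun h : V n => mid a c v (v + h)) :=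
    measurable_mid.comp (f := fun h : V n => (a, c, v, v + h)) (by fun_prop)
  have hΨ : Measurable Ψ := by
    have : Measurable (fun h : V n => ⟪h, zet e κ l⟫ • e) := by fun_prop
    exact (hm2.sub_const v).add this
  let D : Set (V n) := {h | anisoDist v (v + h) ≤ ε ∧ good δ a c v (v + h)}
  have hD : MeasurableSet D := by
    refine measurableSet_and' (measurableSet_le ?_ measurable_const) ?_
    · exact measurable_anisoDist.comp (f := fun h : V n => (v, v + h)) (by fun_prop)
    · exact measurableSet_preimage (f := fun h : V n => (a, c, v, v + h)) (by fun_prop)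
        (measurableSet_good δ)
  have hcore : ∀ x ∈ D, ∀ y ∈ D, ‖x - y‖ ≤ C1 * ‖Ψ x - Ψ y‖ ∧
      |⟪x - y, v - c⟫| ≤ C2 * ‖Ψ x - Ψ y‖ := by
    intro x hx y hy
    obtain ⟨-, -, -, -, -, -, x1, x2, x3, x4, x5, x6, x7⟩ := hsize _ hx
    obtain ⟨-, -, -, -, -, -, y1, y2, y3, y4, y5, y6, y7⟩ := hsize _ hy
    have nx := norm_le_anisoDist v (v + x)
    have ny := norm_le_anisoDist v (v + y)
    rw [add_sub_cancel_left] at x1 x2 x3 x5 x6 y1 y2 y3 y5 y6 nx ny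
    have := expand_core e κ l ρ (2 * R) Cp ε he1 heκ hρ hρκ hκR hε hε1 hCp0.le hε2 x y _ _ _ _ _ _
      x1 y1 x2 y2 x3 y3 (nx.trans hx.1) (ny.trans hy.1)
      (y4.trans (mul_le_mul_of_nonneg_left hy.1 hCp0.le)) (by linarith) x6 _ rfl x7 y7
    rw [← hβ0, ← hC1, ← hC2] at this
    exact this
  have hcore0 : ∀ x ∈ D, ‖x‖ ≤ C1 * ‖Ψ x‖ := by
    intro x hx
    obtain ⟨-, -, -, -, -, -, x1, x2, x3, x4, x5, x6, x7⟩ := hsize _ hx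
    have nx := norm_le_anisoDist v (v + x)
    rw [add_sub_cancel_left] at x1 x2 x3 x6 nx
    have := (expand_core e κ l ρ (2 * R) Cp ε he1 heκ hρ hρκ hκR hε hε1 hCp0.le hε2 x 0 _ 0 _ 0 _ 0
      x1 (by simp) x2 (by simp) x3 (by simp) (nx.trans hx.1) (by simpa using hε.le)
      (by simpa using hεCp.le.trans_eq (mul_comm _ _)) (by simpa using hρκ) x6 _ rfl x7 (by simp)).1
    rw [← hC1] at this
    simpa using this
  have hΨn : ∀ x ∈ D, ‖Ψ x‖ ≤ (Cp + 1) * anisoDist v (v + x) := by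
    intro x hx
    obtain ⟨-, -, -, -, -, -, x1, x2, x3, x4, x5, x6, x7⟩ := hsize _ hx
    have nx := norm_le_anisoDist v (v + x)
    rw [add_sub_cancel_left] at nx
    refine (norm_add_le _ _).trans ?_
    rw [norm_smul, he1, mul_one, Real.norm_eq_abs]
    have := abs_real_inner_le_norm x (zet e κ l)
    rw [hz1, mul_one] at this
    linarith
  let F : V n → ℝ≥0∞ := fun y => if ‖y‖ ≤ ‖v - a‖ then
          ENNReal.ofReal ((Cp + 1) ^ q) * (ENNReal.ofReal (‖y‖ ^ (-q)) * Φ (v + pr (v - a) y)) else 0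
  have hF : Measurable F := by
    refine measurable_ite' (measurableSet_le (by fun_prop) (by fun_prop)) ?_ measurable_const
    have : Measurable (fun y => pr (v - a) y) :=
      measurable_pr.comp (f := fun y : V n => (v - a, y)) (by fun_prop)
    fun_prop
  have hexp := lintegral_expand D hD Ψ hΨ (cmpA (v - c)) (by
      rw [det_cmpA _ hβ0n]; exact norm_ne_zero_iff.2 hβ0n) CE hCE0.le (by
      intro x hx y hy
      refine (norm_cmpA (v - c) _ ρ hρ hρβ).trans ?_
      obtain ⟨k1, k2⟩ := hcore x hx y hy
      have : 0 ≤ 1 + 1 / ρ := by positivity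
      have := mul_le_mul_of_nonneg_left k2 this
      rw [hCE]; linarith) F hF
  rw [det_cmpA _ hβ0n, abs_of_nonneg (norm_nonneg _)] at hexp
  have hFint : ∫⁻ y, F y = ENNReal.ofReal ((Cp + 1) ^ q) * ∫⁻ y, (if ‖y‖ ≤ ‖v - a‖ then
          ENNReal.ofReal (‖y‖ ^ (-q)) * Φ (v + pr (v - a) y) else 0) := by
    rw [← lintegral_const_mul' _ _ ENNReal.ofReal_ne_top]
    congr 1; ext y
    simp only [F]
    split_ifs <;> simp
  rw [hFint, ← mul_assoc, ← ENNReal.ofReal_mul (by positivity)] at hexp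
  have hjap : ‖v - c‖⁻¹ ≤ CJ / jap v := by
    rw [inv_eq_one_div, div_le_div_iff₀ (by linarith) (jap_pos v), one_mul]
    have h1 := jap_le v
    have h2 : ‖v‖ ≤ ‖v - c‖ + ‖c‖ := by
      have := norm_add_le (v - c) c; rwa [sub_add_cancel] at this
    have h3 : (1 + R) ≤ (1 + R) / ρ * ‖v - c‖ := by
      rw [div_mul_eq_mul_div, le_div_iff₀ hρ]
      exact mul_le_mul_of_nonneg_left hρβ (by linarith)
    rw [hCJ]; linarith
  have hconst : ‖v - c‖⁻¹ * CE ^ n * (Cp + 1) ^ q ≤ CJ * CE ^ n * (Cp + 1) ^ q / jap v := by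
    calc ‖v - c‖⁻¹ * CE ^ n * (Cp + 1) ^ q ≤ (CJ / jap v) * CE ^ n * (Cp + 1) ^ q := by gcongr
      _ = _ := by ring
  have hfin := hexp.trans (mul_le_mul_left (ENNReal.ofReal_le_ofReal hconst) _)
  refine le_trans ?_ hfin
  rw [← lintegral_add_left_eq_self _ v, ← lintegral_indicator hD]
  apply lintegral_mono
  intro h
  simp only [indicator]
  split_ifs with h1 h2 h2
  · simp only [F]
    obtain ⟨-, -, -, -, -, -, x1, x2, x3, x4, x5, x6, x7⟩ := hsize _ h1
    have hpr : v + pr (v - a) (Ψ h) = mid a c v (v + h) := by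
      simp only [Ψ]
      rw [pr_add, pr_smul, hpre, smul_zero, add_zero, pr_of_inner _ _ (hαe _ x7)]; abel
    have hn1 := hΨn h h1
    have hle : ‖Ψ h‖ ≤ ‖v - a‖ := by
      have h5 : (Cp + 1) * anisoDist v (v + h) ≤ (Cp + 1) * ε :=
        mul_le_mul_of_nonneg_left h1.1 (by linarith)
      linarith
    rw [if_pos hle, hpr, ← mul_assoc, ← ENNReal.ofReal_mul (by positivity)]
    refine mul_le_mul_left (ENNReal.ofReal_le_ofReal ?_) _
    have hd0 := anisoDist_nonneg v (v + h)
    rcases (norm_nonneg (Ψ h)).eq_or_lt with h0 | h0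
    · have h3 := hcore0 h h1
      rw [← h0, mul_zero] at h3
      have h4 : h = 0 := norm_le_zero_iff.1 h3
      have h5 : anisoDist v (v + h) = 0 := by simp [anisoDist, h4]
      rw [h5, Real.zero_rpow (by linarith)]
      positivity
    · have hd1 : 0 < anisoDist v (v + h) := by
        by_contra hcon
        have : anisoDist v (v + h) = 0 := le_antisymm (not_lt.1 hcon) hd0
        rw [this] at hn1; linarith
      have e1 : (‖Ψ h‖ / (Cp + 1)) ≤ anisoDist v (v + h) := by
        rw [div_le_iff₀ (by linarith)]; linarith
      refine (Real.rpow_le_rpow_of_nonpos (by positivity) e1 (by linarith)).trans_eq ?_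
      rw [Real.div_rpow h0.le (by positivity), Real.rpow_neg (by positivity : 0 ≤ Cp + 1)]
      field_simp
  · exact absurd h1 h2
  · exact zero_le
  · exact le_rfl
end

noncomputable section

lemma jap_comp {n : ℕ} (v w : V n) (h : anisoDist v w ≤ 1) : jap v ≤ 2 * jap w := by
  have h1 := abs_le.1 (abs_le_anisoDist v w)
  unfold jap
  rw [show (2:ℝ) = √4 by rw [show (4:ℝ) = 2 ^ 2 by norm_num]; exact (Real.sqrt_sq (by norm_num)).symm,
    ← Real.sqrt_mul (by norm_num)]
  apply Real.sqrt_le_sqrt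
  nlinarith [h1.1, h1.2, sq_nonneg ‖w‖]

lemma jap_rpow_comp {n : ℕ} (v w : V n) (r : ℝ) (h : anisoDist v w ≤ 1) :
    jap v ^ r ≤ 2 ^ |r| * jap w ^ r :=
  rpow_comp _ _ 2 r (jap_pos w) (jap_pos v) (by norm_num)
    (jap_comp w v (by rwa [anisoDist_symm])) (jap_comp v w h)

/-- the localized integrand -/
def Sk {n : ℕ} (s γ ε : ℝ) (f : V n → ℝ) (v w : V n) : ℝ≥0∞ :=
  if anisoDist v w ≤ ε then
    ENNReal.ofReal (jap v ^ (γ + 2 * s + 1) * anisoDist v w ^ (-((n : ℝ) + 2 * s))) *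
      ENNReal.ofReal ((f w - f v) ^ 2) else 0

open Classical in
def Hk {n : ℕ} (s γ δ ε : ℝ) (f : V n → ℝ) (a c v w : V n) : ℝ≥0∞ :=
  if anisoDist v w ≤ ε ∧ good δ a c v w then
    ENNReal.ofReal (jap v ^ (γ + 2 * s + 1) * anisoDist v w ^ (-((n : ℝ) + 2 * s))) *
      ENNReal.ofReal ((f (mid a c v w) - f v) ^ 2) else 0

lemma measurable_Sk {n : ℕ} (s γ ε : ℝ) {f : V n → ℝ} (hf : Measurable f) :
    Measurable (fun p : V n × V n => Sk s γ ε f p.1 p.2) := by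
  have h1 := measurable_anisoDist (n := n)
  have h2 := measurable_jap (n := n)
  unfold Sk
  refine measurable_ite' (measurableSet_le h1 measurable_const) ?_ measurable_const
  fun_prop

lemma measurable_Hk {n : ℕ} (s γ δ ε : ℝ) {f : V n → ℝ} (hf : Measurable f) (a c : V n) :
    Measurable (fun p : V n × V n => Hk s γ δ ε f a c p.1 p.2) := by
  classical
  have h1 := measurable_anisoDist (n := n)
  have h2 := measurable_jap (n := n)
  unfold Hk
  refine measurable_ite' (measurableSet_and' (measurableSet_le h1 measurable_const) ?_) ?_
    measurable_const
  · exact measurableSet_preimage (f := fun p : V n × V n => (a, c, p.1, p.2)) (by fun_prop)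
        (measurableSet_good δ)
  · have h3 : Measurable (fun p : V n × V n => mid a c p.1 p.2) :=
      measurable_mid.comp (f := fun p : V n × V n => (a, c, p.1, p.2)) (by fun_prop)
    fun_prop

lemma half_pair (n : ℕ) (s γ R δ : ℝ) (hs : 0 < s) (hR : 0 < R) (hδ : 0 < δ) :
    ∃ ε C : ℝ, 0 < ε ∧ ε ≤ 1 ∧ 0 < C ∧ ∀ a c : V n, ‖a‖ ≤ R → ‖c‖ ≤ R →
      ∀ f : V n → ℝ, Measurable f →
      ∫⁻ v, ∫⁻ w, Hk s γ δ ε f a c v w ≤ ENNReal.ofReal C * Ja s γ f a := by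
  classical
  obtain ⟨ε, C, hε, hε1, hC, H⟩ := first_term n ((n : ℝ) + 2 * s) R δ (by positivity) hR hδ
  obtain ⟨K, hK⟩ : ∃ K, K = (1 + R) / δ + 1 + R + 1 := ⟨_, rfl⟩
  have hKp : 0 < (1 + R) / δ := by positivity
  have hK0 : 0 < K := by rw [hK]; positivity
  refine ⟨ε, C * K ^ |γ + 2 * s|, hε, hε1, by rw [hK]; positivity, ?_⟩
  intro a c ha hc f hf
  unfold Ja
  rw [← lintegral_const_mul' _ _ ENNReal.ofReal_ne_top]
  apply lintegral_mono
  intro v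
  simp only
  by_cases hα : δ ≤ ‖v - a‖
  swap
  · have : ∀ w, Hk s γ δ ε f a c v w = 0 := by
      intro w
      unfold Hk
      rw [if_neg]
      rintro ⟨-, hg⟩
      exact hα (hg.2.trans (norm_pr_le _ _))
    simp [this]
  have hα0 : 0 < ‖v - a‖ := by linarith
  have hJ := jap_pos v
  have e1 : ∀ w, Hk s γ δ ε f a c v w = ENNReal.ofReal (jap v ^ (γ + 2 * s + 1)) *
      (if anisoDist v w ≤ ε ∧ good δ a c v w then
          ENNReal.ofReal (anisoDist v w ^ (-((n : ℝ) + 2 * s))) *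
            ENNReal.ofReal ((f (mid a c v w) - f v) ^ 2) else 0) := by
    intro w
    unfold Hk
    split_ifs
    · rw [ENNReal.ofReal_mul (by positivity), mul_assoc]
    · simp
  simp_rw [e1]
  rw [lintegral_const_mul' _ _ ENNReal.ofReal_ne_top]
  refine (mul_le_mul_right (H a c v ha hc (fun x => ENNReal.ofReal ((f x - f v) ^ 2))
    (by fun_prop)) _).trans ?_
  rw [← mul_assoc, ← ENNReal.ofReal_mul (by positivity), ← lintegral_const_mul' _ _ ENNReal.ofReal_ne_top,
    ← lintegral_const_mul' _ _ ENNReal.ofReal_ne_top]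
  apply lintegral_mono
  intro y
  simp only
  split_ifs
  · rw [← mul_assoc (ENNReal.ofReal (jap v ^ (γ + 2 * s + 1) * (C / jap v))),
      ← mul_assoc (ENNReal.ofReal (C * K ^ |γ + 2 * s|)),
      ← ENNReal.ofReal_mul (p := jap v ^ (γ + 2 * s + 1) * (C / jap v)) (by positivity),
      ← ENNReal.ofReal_mul (p := C * K ^ |γ + 2 * s|) (by rw [hK]; positivity)]
    refine mul_le_mul_left (ENNReal.ofReal_le_ofReal ?_) _
    rw [Real.rpow_add hJ, Real.rpow_one,
      show jap v ^ (γ + 2 * s) * jap v * (C / jap v) = C * jap v ^ (γ + 2 * s) by field_simp,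
      ← mul_assoc]
    refine mul_le_mul_of_nonneg_right ?_ (by positivity)
    rw [mul_assoc]
    refine mul_le_mul_of_nonneg_left ?_ hC.le
    have h1 := jap_le v
    have h2 : ‖v‖ ≤ ‖v - a‖ + ‖a‖ := by
      have := norm_add_le (v - a) a; rwa [sub_add_cancel] at this
    have h3 : ‖v - a‖ ≤ ‖v‖ + ‖a‖ := norm_sub_le _ _
    have h4 : (1 + R) ≤ (1 + R) / δ * ‖v - a‖ := by
      rw [div_mul_eq_mul_div, le_div_iff₀ hδ]
      exact mul_le_mul_of_nonneg_left hα (by linarith)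
    have h5 : 1 ≤ jap v := by
      unfold jap; apply Real.one_le_sqrt.2; nlinarith [sq_nonneg ‖v‖]
    have h6 : ‖v‖ ≤ jap v := by
      unfold jap; apply Real.le_sqrt_of_sq_le; linarith
    apply rpow_comp _ _ K _ hα0 hJ
    · rw [hK]; linarith
    · have : R ≤ R * jap v := by nlinarith
      rw [hK]; nlinarith
    · rw [hK]; nlinarith
  · simp

open Classical in
lemma pair {n : ℕ} (hn : 2 ≤ n) (s γ CΦ cb R δ : ℝ) (hs : 0 < s) (hCΦ : 0 < CΦ) (hcb : 0 < cb)
    (hR : 0 < R) (hδ : 0 < δ) :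
    ∃ ε C : ℝ, 0 < ε ∧ ε ≤ 1 ∧ 0 < C ∧ ∀ b : ℝ → ℝ, KernelAssumptions n s cb b →
      ∀ a c : V n, ‖a‖ ≤ R → ‖c‖ ≤ R → ∀ f : V n → ℝ, Measurable f →
      ∫⁻ v, ∫⁻ w, (if good δ a c v w then Sk s γ ε f v w else 0) ≤
        ENNReal.ofReal C * (Ia CΦ γ b f a + Ia CΦ γ b f c) := by
  obtain ⟨ε, C, hε, hε1, hC, H⟩ := half_pair n s γ R δ hs hR hδ
  set r := γ + 2 * s + 1 with hr
  have hcar0 : 0 < carC n s γ CΦ cb := by unfold carC; positivity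
  obtain ⟨C2, hC2⟩ : ∃ C2, C2 = 5 ^ n * carC n s γ CΦ cb := ⟨_, rfl⟩
  have hC20 : 0 < C2 := by rw [hC2]; positivity
  refine ⟨ε, 2 * 2 ^ |r| * (C * C2), hε, hε1, by positivity, ?_⟩
  intro b hb a c ha hc f hf
  have hcar : ∀ a, Ja s γ f a ≤ ENNReal.ofReal C2 * Ia CΦ γ b f a := fun a => by
    rw [hC2]; exact carleman hn hs hCΦ hcb hb f hf a
  have hA := (H a c ha hc f hf).trans (mul_le_mul_right (hcar a) _)
  have hB := (H c a hc ha f hf).trans (mul_le_mul_right (hcar c) _)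
  rw [← mul_assoc, ← ENNReal.ofReal_mul hC.le] at hA hB
  have hM1 := measurable_Hk s γ δ ε hf a c
  have hM2 := measurable_Hk s γ δ ε hf c a
  have hM2' : Measurable (fun p : V n × V n => Hk s γ δ ε f c a p.2 p.1) :=
    hM2.comp (f := fun p : V n × V n => (p.2, p.1)) (by fun_prop)
  have hpt : ∀ v w, (if good δ a c v w then Sk s γ ε f v w else 0) ≤
      ENNReal.ofReal (2 * 2 ^ |r|) * (Hk s γ δ ε f a c v w + Hk s γ δ ε f c a w v) := by
    intro v w
    by_cases hg : good δ a c v w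
    swap
    · simp [hg]
    by_cases hd : anisoDist v w ≤ ε
    swap
    · simp [hg, hd, Sk]
    have hg' := (good_symm δ a c v w).2 hg
    have hd' : anisoDist w v ≤ ε := by rwa [anisoDist_symm]
    simp only [hg, Sk, Hk, hd, hd', hg', and_self, if_true, mid_symm]
    rw [anisoDist_symm v w]
    have hd0 := anisoDist_nonneg v w
    have j1 := jap_pos v
    have j2 := jap_pos w
    rw [← ENNReal.ofReal_mul (by positivity), ← ENNReal.ofReal_mul (by positivity),
      ← ENNReal.ofReal_mul (by positivity), ← ENNReal.ofReal_add (by positivity) (by positivity),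
      ← ENNReal.ofReal_mul (by positivity)]
    apply ENNReal.ofReal_le_ofReal
    have hj := jap_rpow_comp v w r (hd.trans hε1)
    rw [← hr]
    set d := anisoDist v w ^ (-((n : ℝ) + 2 * s)) with hdd
    have hdd0 : 0 ≤ d := by positivity
    set m := f (mid a c v w)
    have h2r : (1:ℝ) ≤ 2 ^ |r| := Real.one_le_rpow (by norm_num) (abs_nonneg _)
    have hsq : (f w - f v) ^ 2 ≤ 2 * (m - f v) ^ 2 + 2 * (m - f w) ^ 2 := by
      nlinarith [sq_nonneg (2 * m - f v - f w)]
    have jv : 0 < jap v ^ r := by positivity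
    calc jap v ^ r * d * (f w - f v) ^ 2 ≤ jap v ^ r * d * (2 * (m - f v) ^ 2 + 2 * (m - f w) ^ 2) := by
          gcongr
      _ = 1 * jap v ^ r * (2 * d * (m - f v) ^ 2) + jap v ^ r * (2 * d * (m - f w) ^ 2) := by ring
      _ ≤ 2 ^ |r| * jap v ^ r * (2 * d * (m - f v) ^ 2) +
          (2 ^ |r| * jap w ^ r) * (2 * d * (m - f w) ^ 2) := by gcongr
      _ = _ := by ring
  calc ∫⁻ v, ∫⁻ w, (if good δ a c v w then Sk s γ ε f v w else 0) ≤
      ∫⁻ v, ∫⁻ w, ENNReal.ofReal (2 * 2 ^ |r|) * (Hk s γ δ ε f a c v w + Hk s γ δ ε f c a w v) :=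
        lintegral_mono fun v => lintegral_mono fun w => hpt v w
    _ = ENNReal.ofReal (2 * 2 ^ |r|) * ((∫⁻ v, ∫⁻ w, Hk s γ δ ε f a c v w) +
          (∫⁻ v, ∫⁻ w, Hk s γ δ ε f c a w v)) := by
        have e1 : ∀ v, ∫⁻ w, ENNReal.ofReal (2 * 2 ^ |r|) *
            (Hk s γ δ ε f a c v w + Hk s γ δ ε f c a w v) = ENNReal.ofReal (2 * 2 ^ |r|) *
            ((∫⁻ w, Hk s γ δ ε f a c v w) + (∫⁻ w, Hk s γ δ ε f c a w v)) := by
          intro v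
          rw [lintegral_const_mul' _ _ ENNReal.ofReal_ne_top, lintegral_add_left]
          exact hM1.comp (f := fun w : V n => (v, w)) (by fun_prop)
        simp_rw [e1]
        rw [lintegral_const_mul' _ _ ENNReal.ofReal_ne_top, lintegral_add_left]
        exact hM1.lintegral_prod_right'
    _ = ENNReal.ofReal (2 * 2 ^ |r|) * ((∫⁻ v, ∫⁻ w, Hk s γ δ ε f a c v w) +
          (∫⁻ w, ∫⁻ v, Hk s γ δ ε f c a w v)) := by
        rw [lintegral_lintegral_swap (f := fun v w => Hk s γ δ ε f c a w v) hM2'.aemeasurable]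
    _ ≤ ENNReal.ofReal (2 * 2 ^ |r|) * (ENNReal.ofReal (C * C2) * Ia CΦ γ b f a +
          ENNReal.ofReal (C * C2) * Ia CΦ γ b f c) :=
        mul_le_mul_right (add_le_add hA hB) _
    _ = _ := by
        rw [← mul_add, ← mul_assoc, ← ENNReal.ofReal_mul (by positivity)]
end

noncomputable section

lemma norm_pr_swap {n : ℕ} (α β : V n) : ‖α‖ * ‖pr α β‖ = ‖β‖ * ‖pr β α‖ := by
  have h1 := norm_pr_sq α β
  have h2 := norm_pr_sq β α
  rw [real_inner_comm] at h2
  have : (‖α‖ * ‖pr α β‖) ^ 2 = (‖β‖ * ‖pr β α‖) ^ 2 := by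
    rw [mul_pow, mul_pow, h1, h2]; ring
  exact (sq_eq_sq₀ (by positivity) (by positivity)).1 this

lemma tube_pt {n : ℕ} (δ : ℝ) (p u x : V n) (h : ¬ infDist x {y | ∃ t : ℝ, y = p + t • u} ≤ δ) (t : ℝ) :
    δ < ‖x - (p + t • u)‖ := by
  push Not at h
  rw [← dist_eq_norm]
  exact h.trans_le (infDist_le_dist_of_mem ⟨t, rfl⟩)

/-- reduced tube radius -/
def del' (R δ : ℝ) : ℝ := δ * δ / (δ + 2 * R + 1)

lemma good_of_tubes {n : ℕ} (R δ : ℝ) (hδ : 0 < δ) (hR : 0 < R) (a c v w : V n)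
    (ha : ‖a‖ ≤ R) (hc : ‖c‖ ≤ R) (hd : anisoDist v w ≤ 1) (h1 : δ < ‖v - a‖)
    (h2 : ¬ infDist c {y | ∃ t : ℝ, y = w + t • (v - a)} ≤ δ) : good (del' R δ) a c v w := by
  set α := v - a with hα
  set β := w - c with hβ
  have hα0 : 0 < ‖α‖ := by linarith
  have h3 : δ < ‖pr α β‖ := by
    have h := tube_pt δ w α c h2
    have hp : ∃ t : ℝ, pr α β = β + t • α := by
      unfold pr
      exact ⟨_, by rw [sub_eq_add_neg, ← neg_smul]⟩
    obtain ⟨t, ht⟩ := hp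
    rw [ht]
    have := h t
    rwa [show c - (w + t • α) = -(β + t • α) by rw [hβ]; abel, norm_neg] at this
  have hb : ‖β‖ ≤ ‖α‖ + 2 * R + 1 := by
    have e : β = α + (w - v) + (a - c) := by rw [hα, hβ]; abel
    have := norm_le_anisoDist v w
    have h4 := norm_sub_le a c
    calc ‖β‖ ≤ ‖α + (w - v)‖ + ‖a - c‖ := by rw [e]; exact norm_add_le _ _
      _ ≤ ‖α‖ + ‖w - v‖ + ‖a - c‖ := by gcongr; exact norm_add_le _ _
      _ ≤ _ := by linarith
  have hsw := norm_pr_swap α β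
  have hD : 0 < δ + 2 * R + 1 := by linarith
  refine ⟨?_, ?_⟩
  · show δ * δ / (δ + 2 * R + 1) ≤ ‖pr α β‖
    rw [div_le_iff₀ hD]
    nlinarith
  · show δ * δ / (δ + 2 * R + 1) ≤ ‖pr β α‖
    rw [div_le_iff₀ hD]
    set P := ‖pr β α‖
    have hP : 0 ≤ P := norm_nonneg _
    have hP' : ‖α‖ * δ ≤ (‖α‖ + 2 * R + 1) * P := by
      calc ‖α‖ * δ ≤ ‖α‖ * ‖pr α β‖ := by gcongr
        _ = ‖β‖ * P := hsw
        _ ≤ _ := by gcongr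
    by_contra! hcon
    by_cases hPd : P ≤ δ
    · nlinarith
    · nlinarith

open Classical in
lemma good_mass {n : ℕ} (hn : 2 ≤ n) (R δ Cg : ℝ) (hδ : 0 < δ) (hR : 0 < R) (hCg : 0 < Cg) (g : V n → ℝ)
    (hg : Measurable g) (hL : AssumptionL R δ Cg g) (v w : V n) (hd : anisoDist v w ≤ 1) :
    ENNReal.ofReal (Cg ^ 2) ≤ ∫⁻ a in closedBall (0 : V n) R, ∫⁻ c in closedBall (0 : V n) R,
      ENNReal.ofReal (g a) * ENNReal.ofReal (g c) *
        (if good (del' R δ) a c v w then 1 else 0) := by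
  have : Nontrivial (V n) := by
    have : Nonempty (Fin n) := ⟨⟨0, by omega⟩⟩
    infer_instance
  obtain ⟨u, hu⟩ := exists_ne (0 : V n)
  have hT := hL _ ⟨v, u, hu, rfl⟩
  set T := {x : V n | infDist x {y | ∃ t : ℝ, y = v + t • u} ≤ δ} with hTdef
  have hTm : MeasurableSet T := measurableSet_le (continuous_infDist_pt _).measurable measurable_const
  have hB : MeasurableSet (closedBall (0 : V n) R) := isClosed_closedBall.measurableSet
  calc ENNReal.ofReal (Cg ^ 2) = ENNReal.ofReal Cg * ENNReal.ofReal Cg := by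
        rw [← ENNReal.ofReal_mul hCg.le, sq]
    _ ≤ (∫⁻ a in closedBall (0 : V n) R \ T, ENNReal.ofReal (g a)) * ENNReal.ofReal Cg := by gcongr
    _ = ∫⁻ a in closedBall (0 : V n) R \ T, ENNReal.ofReal (g a) * ENNReal.ofReal Cg := by
        rw [lintegral_mul_const' _ _ ENNReal.ofReal_ne_top]
    _ ≤ ∫⁻ a in closedBall (0 : V n) R \ T, ∫⁻ c in closedBall (0 : V n) R,
      ENNReal.ofReal (g a) * ENNReal.ofReal (g c) *
        (if good (del' R δ) a c v w then 1 else 0) := by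
        apply setLIntegral_mono' (hB.diff hTm)
        intro a ha
        have haR : ‖a‖ ≤ R := by simpa using ha.1
        have hva : δ < ‖v - a‖ := by
          have := tube_pt δ v u a ha.2 0
          rw [zero_smul, add_zero] at this
          rwa [norm_sub_rev]
        have hne : v - a ≠ 0 := by
          intro h; rw [h, norm_zero] at hva; linarith
        have hT2 := hL _ ⟨w, v - a, hne, rfl⟩
        set T2 := {x : V n | infDist x {y | ∃ t : ℝ, y = w + t • (v - a)} ≤ δ} with hT2def
        have hT2m : MeasurableSet T2 :=
          measurableSet_le (continuous_infDist_pt _).measurable measurable_const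
        calc ENNReal.ofReal (g a) * ENNReal.ofReal Cg ≤ ENNReal.ofReal (g a) *
              ∫⁻ c in closedBall (0 : V n) R \ T2, ENNReal.ofReal (g c) := by gcongr
          _ = ∫⁻ c in closedBall (0 : V n) R \ T2, ENNReal.ofReal (g a) * ENNReal.ofReal (g c) := by
            rw [lintegral_const_mul' _ _ ENNReal.ofReal_ne_top]
          _ ≤ ∫⁻ c in closedBall (0 : V n) R \ T2, ENNReal.ofReal (g a) * ENNReal.ofReal (g c) *
              (if good (del' R δ) a c v w then 1 else 0) := by
            apply setLIntegral_mono' (hB.diff hT2m)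
            intro c hc
            have hcR : ‖c‖ ≤ R := by simpa using hc.1
            rw [if_pos (good_of_tubes R δ hδ hR a c v w haR hcR hd hva hc.2), mul_one]
          _ ≤ _ := lintegral_mono_set diff_subset
    _ ≤ _ := lintegral_mono_set diff_subset
end

noncomputable section

lemma norm_step_sq {n : ℕ} (v h : V n) (t : ℝ) :
    ‖v + t • h‖ ^ 2 = ‖v‖ ^ 2 + 2 * t * ⟪v, h⟫ + t ^ 2 * ‖h‖ ^ 2 := by
  rw [norm_add_sq_real, inner_smul_right, norm_smul, mul_pow, Real.norm_eq_abs, sq_abs]; ring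

lemma step_dist {n : ℕ} (v h : V n) (t τ : ℝ) (ht : 0 ≤ t) (hτ : 0 ≤ τ) (htτ : t + τ ≤ 1)
    (hD : anisoDist v (v + h) ≤ 1) :
    anisoDist (v + t • h) (v + t • h + τ • h) ≤ 2 * (τ * anisoDist v (v + h)) := by
  set D := anisoDist v (v + h) with hDdef
  have hD0 : 0 ≤ D := anisoDist_nonneg _ _
  have h1 : ‖h‖ ≤ D := by
    have := norm_le_anisoDist v (v + h); rwa [add_sub_cancel_left] at this
  have h2 := abs_le.1 (abs_le_anisoDist v (v + h))
  rw [norm_add_sq_real, ← hDdef] at h2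
  have e1 : ‖v + t • h + τ • h‖ ^ 2 = ‖v‖ ^ 2 + 2 * (t + τ) * ⟪v, h⟫ + (t + τ) ^ 2 * ‖h‖ ^ 2 := by
    rw [add_assoc, ← add_smul, norm_step_sq]
  have e3 : ‖v + t • h - (v + t • h + τ • h)‖ ^ 2 = τ ^ 2 * ‖h‖ ^ 2 := by
    rw [sub_add_cancel_left, norm_neg, norm_smul, mul_pow, Real.norm_eq_abs, sq_abs]
  unfold anisoDist
  rw [e1, norm_step_sq, e3]
  set I := ⟪v, h⟫
  set m := ‖h‖ ^ 2 with hm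
  have hm0 : 0 ≤ m := by positivity
  have hmD : m ≤ D ^ 2 := by rw [hm]; gcongr
  have hmD' : m ≤ D := hmD.trans (by nlinarith)
  rw [Real.sqrt_le_left (by positivity)]
  have e4 : ‖v‖ ^ 2 + 2 * t * I + t ^ 2 * m - (‖v‖ ^ 2 + 2 * (t + τ) * I + (t + τ) ^ 2 * m)
      = -(τ * (2 * I + m + (2 * t + τ - 1) * m)) := by ring
  rw [e4]
  have h5 : (2 * I + m + (2 * t + τ - 1) * m) ^ 2 ≤ (3 * D) ^ 2 := by
    apply sq_le_sq'
    · nlinarith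
    · nlinarith
  have hτ2 : 0 ≤ τ ^ 2 := by positivity
  nlinarith [mul_le_mul_of_nonneg_left h5 hτ2, mul_le_mul_of_nonneg_left hmD hτ2,
    mul_nonneg hτ2 (sq_nonneg D)]

lemma step_jap {n : ℕ} (v h : V n) (t r : ℝ) (ht : 0 ≤ t) (ht1 : t ≤ 1)
    (hD : anisoDist v (v + h) ≤ 1) : jap v ^ r ≤ 2 ^ |r| * jap (v + t • h) ^ r := by
  have hD0 : 0 ≤ anisoDist v (v + h) := anisoDist_nonneg _ _
  have h1 : ‖h‖ ≤ 1 := by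
    have := norm_le_anisoDist v (v + h); rw [add_sub_cancel_left] at this; linarith
  have h2 := abs_le.1 (abs_le_anisoDist v (v + h))
  rw [norm_add_sq_real] at h2
  have e2 := norm_step_sq v h t
  set I := ⟪v, h⟫
  set m := ‖h‖ ^ 2 with hm
  have hm0 : 0 ≤ m := by positivity
  have hm1 : m ≤ 1 := by rw [hm]; nlinarith [norm_nonneg h]
  have e3 : ‖v + t • h‖ ^ 2 = ‖v‖ ^ 2 + t * (2 * I + m) - t * (1 - t) * m := by rw [e2]; ring
  have b1 : t * (1 - t) * m ≤ 1 := by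
    have : t * (1 - t) ≤ 1 := by nlinarith
    have : 0 ≤ t * (1 - t) := by nlinarith
    nlinarith
  have b0 : 0 ≤ t * (1 - t) * m := mul_nonneg (mul_nonneg ht (by linarith)) hm0
  have b2 : t * (2 * I + m) ≤ 2 := by nlinarith
  have b3 : -2 ≤ t * (2 * I + m) := by nlinarith
  have key : ∀ x y : V n, ‖x‖ ^ 2 ≤ ‖y‖ ^ 2 + 3 → jap x ≤ 2 * jap y := by
    intro x y hxy
    unfold jap
    rw [show (2:ℝ) = √4 by rw [show (4:ℝ) = 2 ^ 2 by norm_num]; exact (Real.sqrt_sq (by norm_num)).symm,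
      ← Real.sqrt_mul (by norm_num)]
    apply Real.sqrt_le_sqrt
    nlinarith [sq_nonneg ‖y‖]
  refine rpow_comp _ _ 2 r (jap_pos _) (jap_pos v) (by norm_num) (key _ _ ?_) (key _ _ ?_) <;>
    linarith

/-- integrand of the seminorm -/
def Nk {n : ℕ} (s γ : ℝ) (f : V n → ℝ) (v w : V n) : ℝ≥0∞ :=
  if anisoDist v w ≤ 1 then
    ENNReal.ofReal ((jap v * jap w) ^ ((γ + 2 * s + 1) / 2) * (f w - f v) ^ 2 *
      anisoDist v w ^ (-((n : ℝ) + 2 * s))) else 0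

/-- chain constant -/
def chC (n : ℕ) (s γ : ℝ) (k : ℕ) : ℝ :=
  2 ^ |(γ + 2 * s + 1) / 2| * 2 ^ |γ + 2 * s + 1| * 2 ^ ((n : ℝ) + 2 * s) * k

lemma chain_pt {n : ℕ} (s γ ε : ℝ) (hs : 0 < s) (k : ℕ) (hk : 0 < k) (hkε : 2 ≤ ε * k)
    (f : V n → ℝ) (v h : V n) :
    Nk s γ f v (v + h) ≤ ∑ j ∈ Finset.range k, ENNReal.ofReal (chC n s γ k) *
      Sk s γ ε f (v + ((j : ℝ) / k) • h) (v + ((j : ℝ) / k) • h + (1 / (k : ℝ)) • h) := by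
  have hk0 : (0:ℝ) < k := by exact_mod_cast hk
  unfold Nk
  split_ifs with hD
  swap
  · exact zero_le
  by_cases hh : h = 0
  · simp [hh]
  set p := (n : ℝ) + 2 * s with hp
  have hp0 : 0 < p := by positivity
  set r := γ + 2 * s + 1 with hr
  set D := anisoDist v (v + h) with hDd
  set x : ℕ → V n := fun j => v + ((j : ℝ) / k) • h with hx
  have hx1 : ∀ j : ℕ, v + ((j : ℝ) / k) • h + (1 / (k : ℝ)) • h = x (j + 1) := by
    intro j
    simp only [hx]
    push_cast
    module
  have hxk : x k = v + h := by simp [hx, hk0.ne']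
  have hx0 : x 0 = v := by simp [hx]
  have hd : ∀ j ∈ Finset.range k, anisoDist (x j) (x (j + 1)) ≤ 2 / k * D := by
    intro j hj
    rw [← hx1]
    have hj' : (j : ℝ) + 1 ≤ k := by exact_mod_cast Finset.mem_range.1 hj
    have := step_dist v h ((j : ℝ) / k) (1 / k) (by positivity) (by positivity)
      (by rw [← add_div, div_le_one hk0]; exact hj') hD
    calc _ ≤ _ := this
      _ = _ := by ring
  have hd0 : ∀ j, 0 < anisoDist (x j) (x (j + 1)) := by
    intro j
    refine lt_of_lt_of_le ?_ (norm_le_anisoDist _ _)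
    rw [← hx1, show x j = v + ((j : ℝ) / k) • h from rfl, add_sub_cancel_left, norm_smul]
    have := norm_pos_iff.2 hh
    have h2 : 0 < ‖1 / (k:ℝ)‖ := norm_pos_iff.2 (by positivity)
    positivity
  have hD0 : 0 ≤ D := anisoDist_nonneg _ _
  have hk1 : (1:ℝ) ≤ k := by exact_mod_cast hk
  have hsum : (f (v + h) - f v) ^ 2 ≤ k * ∑ j ∈ Finset.range k, (f (x (j + 1)) - f (x j)) ^ 2 := by
    have e := Finset.sum_range_sub (fun j => f (x j)) k
    rw [hxk, hx0] at e
    rw [← e]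
    have := sq_sum_le_card_mul_sum_sq (s := Finset.range k) (f := fun j => f (x (j + 1)) - f (x j))
    rwa [Finset.card_range] at this
  have jv := jap_pos v
  have hjj : (jap v * jap (v + h)) ^ (r / 2) ≤ 2 ^ |r / 2| * jap v ^ r := by
    have hj2 := jap_pos (v + h)
    have c1 := jap_comp v (v + h) hD
    have c2 := jap_comp (v + h) v (by rwa [anisoDist_symm])
    have := rpow_comp (jap v * jap v) (jap v * jap (v + h)) 2 (r / 2) (by positivity) (by positivity)
      (by norm_num) (by nlinarith) (by nlinarith)
    rwa [← sq, ← Real.rpow_natCast (jap v) 2, ← Real.rpow_mul jv.le,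
      show ((2:ℕ):ℝ) * (r / 2) = r by push_cast; ring] at this
  have hterm : ∀ j ∈ Finset.range k,
      2 ^ |r / 2| * jap v ^ r * (k * (f (x (j + 1)) - f (x j)) ^ 2) * D ^ (-p) ≤
      chC n s γ k * (jap (x j) ^ r * anisoDist (x j) (x (j + 1)) ^ (-p) *
        (f (x (j + 1)) - f (x j)) ^ 2) := by
    intro j hj
    have hj' : (j : ℝ) + 1 ≤ k := by exact_mod_cast Finset.mem_range.1 hj
    have g1 := step_jap v h ((j : ℝ) / k) r (by positivity)
      (by rw [div_le_one hk0]; linarith) hD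
    have g2 : D ^ (-p) ≤ 2 ^ p * anisoDist (x j) (x (j + 1)) ^ (-p) := by
      have q := hd0 j
      have : anisoDist (x j) (x (j + 1)) / 2 ≤ D := by
        have := hd j hj
        have h2 : 2 / (k : ℝ) ≤ 2 := div_le_self (by norm_num) hk1
        nlinarith
      calc D ^ (-p) ≤ (anisoDist (x j) (x (j + 1)) / 2) ^ (-p) :=
            Real.rpow_le_rpow_of_nonpos (by positivity) this (by linarith)
        _ = _ := by
            rw [Real.div_rpow q.le (by norm_num), Real.rpow_neg (by norm_num : (0:ℝ) ≤ 2)]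
            rw [div_inv_eq_mul, mul_comm]
    have q := hd0 j
    have jx := jap_pos (x j)
    unfold chC
    rw [← hr, ← hp]
    calc 2 ^ |r / 2| * jap v ^ r * (k * (f (x (j + 1)) - f (x j)) ^ 2) * D ^ (-p)
        ≤ 2 ^ |r / 2| * (2 ^ |r| * jap (x j) ^ r) * (k * (f (x (j + 1)) - f (x j)) ^ 2) *
          (2 ^ p * anisoDist (x j) (x (j + 1)) ^ (-p)) := by
          gcongr
      _ = _ := by ring
  have hch : 0 ≤ chC n s γ k := by unfold chC; positivity
  calc ENNReal.ofReal ((jap v * jap (v + h)) ^ (r / 2) * (f (v + h) - f v) ^ 2 * D ^ (-p))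
      ≤ ENNReal.ofReal (∑ j ∈ Finset.range k,
        2 ^ |r / 2| * jap v ^ r * (k * (f (x (j + 1)) - f (x j)) ^ 2) * D ^ (-p)) := by
        apply ENNReal.ofReal_le_ofReal
        rw [← Finset.sum_mul, ← Finset.mul_sum, ← Finset.mul_sum]
        gcongr
    _ = ∑ j ∈ Finset.range k, ENNReal.ofReal
        (2 ^ |r / 2| * jap v ^ r * (k * (f (x (j + 1)) - f (x j)) ^ 2) * D ^ (-p)) := by
        rw [ENNReal.ofReal_sum_of_nonneg]
        intro j hj; positivity
    _ ≤ _ := by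
        apply Finset.sum_le_sum
        intro j hj
        rw [hx1]
        have : anisoDist (x j) (x (j + 1)) ≤ ε := by
          refine (hd j hj).trans ?_
          calc 2 / k * D ≤ 2 / k * 1 := by gcongr
            _ ≤ ε := by rw [mul_one, div_le_iff₀ hk0]; exact hkε
        have q := hd0 j
        have jx := jap_pos (x j)
        show _ ≤ _ * Sk s γ ε f (x j) (x (j + 1))
        unfold Sk
        rw [if_pos this, ← ENNReal.ofReal_mul (by positivity), ← ENNReal.ofReal_mul hch]
        exact ENNReal.ofReal_le_ofReal (hterm j hj)

lemma lintegral_scale {n : ℕ} (c : ℝ) (hc : 0 < c) (F : V n → ℝ≥0∞) (hF : Measurable F) :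
    ∫⁻ h, F (c • h) = ENNReal.ofReal ((c ^ n)⁻¹) * ∫⁻ h, F h := by
  have h1 := Measure.map_addHaar_smul (volume : Measure (V n)) hc.ne'
  rw [← lintegral_map hF (by fun_prop), h1, lintegral_smul_measure, abs_of_nonneg (by positivity)]
  simp

end

noncomputable section

lemma chain_step {n : ℕ} (s γ ε : ℝ) (k : ℕ) (hk : 0 < k) (f : V n → ℝ) (hf : Measurable f) (j : ℕ) :
    ∫⁻ v, ∫⁻ h, Sk s γ ε f (v + ((j : ℝ) / k) • h)
      (v + ((j : ℝ) / k) • h + (1 / (k : ℝ)) • h) =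
      ENNReal.ofReal ((1 / (k:ℝ)) ^ n)⁻¹ * ∫⁻ v, ∫⁻ w, Sk s γ ε f v w := by
  have hkr : (0:ℝ) < k := by exact_mod_cast hk
  have hM := measurable_Sk s γ ε hf
  have m1 : Measurable (fun q : V n × V n => Sk s γ ε f (q.1 + ((j : ℝ) / k) • q.2)
      (q.1 + ((j : ℝ) / k) • q.2 + (1 / (k : ℝ)) • q.2)) :=
    hM.comp (f := fun q : V n × V n => (q.1 + ((j : ℝ) / k) • q.2,
      q.1 + ((j : ℝ) / k) • q.2 + (1 / (k : ℝ)) • q.2)) (by fun_prop)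
  have m2 : Measurable (fun q : V n × V n => Sk s γ ε f q.2 (q.2 + (1 / (k : ℝ)) • q.1)) :=
    hM.comp (f := fun q : V n × V n => (q.2, q.2 + (1 / (k : ℝ)) • q.1)) (by fun_prop)
  have m3 : ∀ v, Measurable (fun h : V n => Sk s γ ε f v (v + h)) := fun v =>
    hM.comp (f := fun h : V n => (v, v + h)) (by fun_prop)
  calc _ = ∫⁻ h, ∫⁻ v, Sk s γ ε f (v + ((j : ℝ) / k) • h)
        (v + ((j : ℝ) / k) • h + (1 / (k : ℝ)) • h) :=
        lintegral_lintegral_swap m1.aemeasurable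
    _ = ∫⁻ h : V n, ∫⁻ v, Sk s γ ε f v (v + (1 / (k : ℝ)) • h) := by
        congr 1; ext h
        rw [lintegral_add_right_eq_self (fun v => Sk s γ ε f v (v + (1 / (k : ℝ)) • h))]
    _ = ∫⁻ v, ∫⁻ h : V n, Sk s γ ε f v (v + (1 / (k : ℝ)) • h) :=
        lintegral_lintegral_swap m2.aemeasurable
    _ = ∫⁻ v, ENNReal.ofReal ((1 / (k:ℝ)) ^ n)⁻¹ * ∫⁻ w, Sk s γ ε f v w := by
        congr 1; ext v
        rw [lintegral_scale (1 / (k:ℝ)) (by positivity) (fun h => Sk s γ ε f v (v + h))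
          (m3 v),
          lintegral_add_left_eq_self (fun h => Sk s γ ε f v h)]
    _ = _ := lintegral_const_mul' _ _ ENNReal.ofReal_ne_top

lemma chain (n : ℕ) (s γ ε : ℝ) (hs : 0 < s) (hε : 0 < ε) : ∃ C : ℝ, 0 < C ∧ ∀ f : V n → ℝ, Measurable f →
    NdotSq s γ f ≤ ENNReal.ofReal C * ∫⁻ v, ∫⁻ w, Sk s γ ε f v w := by
  obtain ⟨k0, hk0⟩ := exists_nat_gt (2 / ε)
  obtain ⟨k, hkk⟩ : ∃ k, k = k0 + 1 := ⟨_, rfl⟩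
  have hk : 0 < k := by omega
  have hkr : (0:ℝ) < k := by exact_mod_cast hk
  have hkε : 2 ≤ ε * k := by
    rw [div_lt_iff₀ hε] at hk0
    rw [hkk]; push_cast; nlinarith
  have hch : 0 < chC n s γ k := by unfold chC; positivity
  refine ⟨k * (chC n s γ k * ((1 / (k:ℝ)) ^ n)⁻¹), by positivity, ?_⟩
  intro f hf
  have hM := measurable_Sk s γ ε hf
  have m1 : ∀ j : ℕ, Measurable (fun q : V n × V n =>
      ENNReal.ofReal (chC n s γ k) * Sk s γ ε f (q.1 + ((j : ℝ) / k) • q.2)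
      (q.1 + ((j : ℝ) / k) • q.2 + (1 / (k : ℝ)) • q.2)) := fun j =>
    (hM.comp (f := fun q : V n × V n => (q.1 + ((j : ℝ) / k) • q.2,
      q.1 + ((j : ℝ) / k) • q.2 + (1 / (k : ℝ)) • q.2)) (by fun_prop)).const_mul _
  have hj := chain_step s γ ε k hk f hf
  calc NdotSq s γ f = ∫⁻ v, ∫⁻ h, Nk s γ f v (v + h) := by
        unfold NdotSq
        congr 1; ext v
        rw [lintegral_add_left_eq_self (fun w => Nk s γ f v w)]
        rfl
    _ ≤ ∫⁻ v, ∫⁻ h, ∑ j ∈ Finset.range k, ENNReal.ofReal (chC n s γ k) *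
      Sk s γ ε f (v + ((j : ℝ) / k) • h) (v + ((j : ℝ) / k) • h + (1 / (k : ℝ)) • h) :=
        lintegral_mono fun v => lintegral_mono fun h => chain_pt s γ ε hs k hk hkε f v h
    _ = ∑ j ∈ Finset.range k, ∫⁻ v, ∫⁻ h, ENNReal.ofReal (chC n s γ k) *
      Sk s γ ε f (v + ((j : ℝ) / k) • h) (v + ((j : ℝ) / k) • h + (1 / (k : ℝ)) • h) := by
        rw [← lintegral_finsetSum]
        · congr 1; ext v
          rw [lintegral_finsetSum]
          intro j _
          exact (m1 j).comp (f := fun h : V n => (v, h)) (by fun_prop)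
        · intro j _
          exact (m1 j).lintegral_prod_right'
    _ = ∑ j ∈ Finset.range k, ENNReal.ofReal (chC n s γ k) *
          (ENNReal.ofReal ((1 / (k:ℝ)) ^ n)⁻¹ * ∫⁻ v, ∫⁻ w, Sk s γ ε f v w) := by
        apply Finset.sum_congr rfl
        intro j _
        simp_rw [lintegral_const_mul' _ _ ENNReal.ofReal_ne_top]
        rw [hj]
    _ = _ := by
        rw [Finset.sum_const, Finset.card_range, nsmul_eq_mul, ← mul_assoc, ← mul_assoc,
          ENNReal.ofReal_mul (by positivity), ENNReal.ofReal_mul (by positivity),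
          ENNReal.ofReal_natCast, ← mul_assoc]
end

noncomputable section

lemma Ng_eq {n : ℕ} (s CΦ γ cb : ℝ) (hCΦ : 0 < CΦ) (b : ℝ → ℝ) (hb : KernelAssumptions n s cb b)
    (g f : V n → ℝ) (hg : Measurable g) (hg0 : ∀ v, 0 ≤ g v) (hf : Measurable f) :
    Ng CΦ γ b g f = 2⁻¹ * ∫⁻ a, ENNReal.ofReal (g a) * Ia CΦ γ b f a := by
  have mB := measurable_Bker (n := n) CΦ γ hb.1
  have mv := measurable_vprime (n := n)
  have hpt : ∀ v a σ : V n, ENNReal.ofReal (Bker CΦ γ b v a σ * g a * (f (vprime v a σ) - f v) ^ 2)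
      = ENNReal.ofReal (g a) *
        (ENNReal.ofReal (Bker CΦ γ b v a σ) * ENNReal.ofReal ((f (vprime v a σ) - f v) ^ 2)) := by
    intro v a σ
    have hB : 0 ≤ Bker CΦ γ b v a σ := by
      unfold Bker
      have := hb.2.1 ⟪‖v - a‖⁻¹ • (v - a), σ⟫
      positivity
    rw [← ENNReal.ofReal_mul hB, ← ENNReal.ofReal_mul (hg0 a)]
    congr 1; ring
  have mm : Measurable (fun p : (V n × V n) × sphere (0 : V n) 1 =>
      ENNReal.ofReal (g p.1.2) * (ENNReal.ofReal (Bker CΦ γ b p.1.1 p.1.2 p.2) *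
        ENNReal.ofReal ((f (vprime p.1.1 p.1.2 p.2) - f p.1.1) ^ 2))) := by
    have c1 : Measurable (fun p : (V n × V n) × sphere (0 : V n) 1 =>
        (p.1.1, p.1.2, (p.2 : V n))) := by fun_prop
    have m1 := mB.comp c1
    have m2 := mv.comp c1
    simp only [Function.comp_def] at m1 m2
    fun_prop
  unfold Ng
  congr 1
  simp_rw [hpt]
  rw [lintegral_lintegral_swap (f := fun v a => ∫⁻ σ : sphere (0 : V n) 1, ENNReal.ofReal (g a) *
        (ENNReal.ofReal (Bker CΦ γ b v a σ) * ENNReal.ofReal ((f (vprime v a σ) - f v) ^ 2))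
          ∂sphMeas n) mm.lintegral_prod_right'.aemeasurable]
  simp_rw [lintegral_const_mul' _ _ ENNReal.ofReal_ne_top]
  rfl

open Classical in
lemma upper {n : ℕ} (G : ℝ≥0∞) (B : Set (V n)) (hB : MeasurableSet B) (g : V n → ℝ) (hg : Measurable g)
    (hG : G = ∫⁻ x in B, ENNReal.ofReal (g x)) (hGt : G < ⊤) (I : V n → ℝ≥0∞) :
    ∫⁻ a in B, ∫⁻ c in B, ENNReal.ofReal (g a) * ENNReal.ofReal (g c) * (I a + I c)
      = 2 * G * ∫⁻ a in B, ENNReal.ofReal (g a) * I a := by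
  have mg : Measurable (fun a => ENNReal.ofReal (g a)) := by fun_prop
  have e1 : ∀ a, ∫⁻ c in B, ENNReal.ofReal (g a) * ENNReal.ofReal (g c) * (I a + I c)
      = ENNReal.ofReal (g a) * I a * G + ENNReal.ofReal (g a) * ∫⁻ c in B, ENNReal.ofReal (g c) * I c := by
    intro a
    rw [← lintegral_const_mul' _ _ ENNReal.ofReal_ne_top, hG, ← lintegral_const_mul _ mg,
      ← lintegral_add_left (mg.const_mul _)]
    congr 1; ext c; ring
  simp_rw [e1]
  rw [lintegral_add_right _ (mg.mul_const _), lintegral_mul_const' _ _ hGt.ne,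
    lintegral_mul_const _ mg, ← hG]
  ring

open Classical in
lemma tonelli4 {n : ℕ} (B : Set (V n)) (F : V n → V n → V n → V n → ℝ≥0∞)
    (hF : Measurable (fun p : (V n × V n) × (V n × V n) => F p.1.1 p.1.2 p.2.1 p.2.2)) :
    ∫⁻ v, ∫⁻ w, ∫⁻ a in B, ∫⁻ c in B, F a c v w =
    ∫⁻ a in B, ∫⁻ c in B, ∫⁻ v, ∫⁻ w, F a c v w := by
  have hF' : Measurable (fun p : (V n × V n) × (V n × V n) => F p.2.1 p.2.2 p.1.1 p.1.2) :=
    hF.comp measurable_swap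
  set μ := (volume : Measure (V n)).restrict B
  have l : ∀ v w, ∫⁻ a, ∫⁻ c, F a c v w ∂μ ∂μ =
      ∫⁻ q : V n × V n, F q.1 q.2 v w ∂(μ.prod μ) := by
    intro v w
    rw [lintegral_prod]
    exact (hF.comp (f := fun q : V n × V n => (q, (v, w))) (by fun_prop)).aemeasurable
  have r : ∀ a c, ∫⁻ v, ∫⁻ w, F a c v w =
      ∫⁻ q : V n × V n, F a c q.1 q.2 ∂((volume : Measure (V n)).prod volume) := by
    intro a c
    rw [lintegral_prod]
    exact (hF.comp (f := fun q : V n × V n => ((a, c), q)) (by fun_prop)).aemeasurable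
  simp_rw [l, r]
  have l2 := lintegral_prod (μ := (volume : Measure (V n))) (ν := volume) (fun p : V n × V n =>
    ∫⁻ q : V n × V n, F q.1 q.2 p.1 p.2 ∂(μ.prod μ)) hF'.lintegral_prod_right'.aemeasurable
  have r2 := lintegral_prod (μ := μ) (ν := μ) (fun p : V n × V n =>
    ∫⁻ q : V n × V n, F p.1 p.2 q.1 q.2 ∂((volume : Measure (V n)).prod volume))
    hF.lintegral_prod_right'.aemeasurable
  rw [← l2, ← r2]
  exact lintegral_lintegral_swap (f := fun (p q : V n × V n) => F q.1 q.2 p.1 p.2) hF'.aemeasurable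

open Classical in
lemma assemble {n : ℕ} (hn : 2 ≤ n) (s γ CΦ cb R δ ε Cp : ℝ) (hCΦ : 0 < CΦ)
    (hR : 0 < R) (hδ : 0 < δ) (hε1 : ε ≤ 1) (hCp : 0 < Cp)
    (b : ℝ → ℝ) (hb : KernelAssumptions n s cb b)
    (f : V n → ℝ) (hf : Measurable f)
    (H : ∀ a c : V n, ‖a‖ ≤ R → ‖c‖ ≤ R →
      ∫⁻ v, ∫⁻ w, (if good (del' R δ) a c v w then Sk s γ ε f v w else 0) ≤
        ENNReal.ofReal Cp * (Ia CΦ γ b f a + Ia CΦ γ b f c))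
    (g : V n → ℝ) (hg : Measurable g) (hg0 : ∀ v, 0 ≤ g v)
    (hG : (∫⁻ x in closedBall (0 : V n) R, ENNReal.ofReal (g x)) < ⊤)
    (Cg : ℝ) (hCg : 0 < Cg) (hL : AssumptionL R δ Cg g) :
    ENNReal.ofReal (Cg ^ 2) * (∫⁻ v, ∫⁻ w, Sk s γ ε f v w) ≤
      ENNReal.ofReal (4 * Cp) * ((∫⁻ x in closedBall (0 : V n) R, ENNReal.ofReal (g x)) *
        Ng CΦ γ b g f) := by
  set B := closedBall (0 : V n) R with hBd
  have hB : MeasurableSet B := isClosed_closedBall.measurableSet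
  set G := ∫⁻ x in B, ENNReal.ofReal (g x) with hGd
  set F : V n → V n → V n → V n → ℝ≥0∞ := fun a c v w =>
    ENNReal.ofReal (g a) * ENNReal.ofReal (g c) *
      (if good (del' R δ) a c v w then Sk s γ ε f v w else 0) with hFd
  have mF : Measurable (fun p : (V n × V n) × (V n × V n) => F p.1.1 p.1.2 p.2.1 p.2.2) := by
    have m1 : MeasurableSet {p : (V n × V n) × (V n × V n) | good (del' R δ) p.1.1 p.1.2 p.2.1 p.2.2} :=
      measurableSet_preimage (f := fun p : (V n × V n) × (V n × V n) => (p.1.1, p.1.2, p.2.1, p.2.2))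
        (by fun_prop) (measurableSet_good (del' R δ))
    have m2 : Measurable (fun p : (V n × V n) × (V n × V n) => Sk s γ ε f p.2.1 p.2.2) :=
      (measurable_Sk s γ ε hf).comp measurable_snd
    have m3 := measurable_ite' m1 m2 (measurable_const (a := (0 : ℝ≥0∞)))
    have m4 : Measurable (fun p : (V n × V n) × (V n × V n) =>
      ENNReal.ofReal (g p.1.1) * ENNReal.ofReal (g p.1.2)) := by fun_prop
    exact m4.mul m3
  calc ENNReal.ofReal (Cg ^ 2) * (∫⁻ v, ∫⁻ w, Sk s γ ε f v w)
      = ∫⁻ v, ∫⁻ w, ENNReal.ofReal (Cg ^ 2) * Sk s γ ε f v w := by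
        simp_rw [lintegral_const_mul' _ _ ENNReal.ofReal_ne_top]
    _ ≤ ∫⁻ v, ∫⁻ w, ∫⁻ a in B, ∫⁻ c in B, F a c v w := by
        apply lintegral_mono; intro v
        apply lintegral_mono; intro w
        simp only
        by_cases hd : anisoDist v w ≤ 1
        swap
        · have : Sk s γ ε f v w = 0 := by
            unfold Sk; rw [if_neg]; intro h; exact hd (h.trans hε1)
          rw [this, mul_zero]; exact zero_le
        refine (mul_le_mul_left (good_mass hn R δ Cg hδ hR hCg g hg hL v w hd) _).trans ?_
        have hS : Sk s γ ε f v w ≠ ⊤ := by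
          unfold Sk
          split_ifs
          · exact ENNReal.mul_ne_top ENNReal.ofReal_ne_top ENNReal.ofReal_ne_top
          · simp
        rw [← lintegral_mul_const' _ _ hS]
        apply le_of_eq
        congr 1; ext a
        rw [← lintegral_mul_const' _ _ hS]
        congr 1; ext c
        simp only [hFd]
        split_ifs <;> simp
    _ = ∫⁻ a in B, ∫⁻ c in B, ∫⁻ v, ∫⁻ w, F a c v w := tonelli4 B F mF
    _ ≤ ∫⁻ a in B, ∫⁻ c in B, ENNReal.ofReal (g a) * ENNReal.ofReal (g c) *
          (ENNReal.ofReal Cp * (Ia CΦ γ b f a + Ia CΦ γ b f c)) := by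
        apply setLIntegral_mono' hB; intro a ha
        apply setLIntegral_mono' hB; intro c hc
        have hne : ENNReal.ofReal (g a) * ENNReal.ofReal (g c) ≠ ⊤ :=
          ENNReal.mul_ne_top ENNReal.ofReal_ne_top ENNReal.ofReal_ne_top
        simp only [hFd]
        simp_rw [lintegral_const_mul' _ _ hne]
        exact mul_le_mul_right (H a c (by simpa [hBd] using ha) (by simpa [hBd] using hc)) _
    _ = ENNReal.ofReal Cp * ∫⁻ a in B, ∫⁻ c in B, ENNReal.ofReal (g a) * ENNReal.ofReal (g c) *
          (Ia CΦ γ b f a + Ia CΦ γ b f c) := by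
        simp_rw [← lintegral_const_mul' _ _ ENNReal.ofReal_ne_top]
        congr 1; ext a; congr 1; ext c; ring
    _ = ENNReal.ofReal Cp * (2 * G * ∫⁻ a in B, ENNReal.ofReal (g a) * Ia CΦ γ b f a) := by
        rw [upper G B hB g hg hGd hG (Ia CΦ γ b f)]
    _ ≤ ENNReal.ofReal Cp * (2 * G * ∫⁻ a, ENNReal.ofReal (g a) * Ia CΦ γ b f a) := by
        gcongr
        exact Measure.restrict_le_self
    _ = _ := by
        rw [Ng_eq s CΦ γ cb hCΦ b hb g f hg hg0 hf, ENNReal.ofReal_mul (by norm_num),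
          show ENNReal.ofReal 4 = 2 * 2 by norm_num [ENNReal.ofReal]]
        set J := ∫⁻ a, ENNReal.ofReal (g a) * Ia CΦ γ b f a
        have : (2:ℝ≥0∞) * 2⁻¹ = 1 := ENNReal.mul_inv_cancel (by norm_num) (by norm_num)
        calc _ = ENNReal.ofReal Cp * (2 * G * J) * 1 := by ring
          _ = _ := by rw [← this]; ring

theorem main_coercive_inequality_aux
    (n : ℕ) (hn : 2 ≤ n) (s γ CΦ cb R δ : ℝ)
    (hs : s ∈ Set.Ioo (0:ℝ) 1) (hγ : -(n:ℝ) < γ) (hCΦ : 0 < CΦ) (hcb : 0 < cb)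
    (hδ : 0 < δ) (hδR : δ < R) :
    ∃ C : ℝ, 0 < C ∧
      ∀ b : ℝ → ℝ, KernelAssumptions n s cb b →
      ∀ g : V n → ℝ, Measurable g → (∀ v, 0 ≤ g v) →
        (∫⁻ x in Metric.closedBall (0 : V n) R, ENNReal.ofReal (g x)) < ⊤ →
      ∀ Cg : ℝ, 0 < Cg → AssumptionL R δ Cg g →
      ∀ f : V n → ℝ, Measurable f →
        ENNReal.ofReal (C * Cg ^ 2) * NdotSq s γ f ≤
          (∫⁻ x in Metric.closedBall (0 : V n) R, ENNReal.ofReal (g x)) *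
            Ng CΦ γ b g f := by
  have hR : 0 < R := hδ.trans hδR
  have hd' : 0 < del' R δ := by unfold del'; positivity
  obtain ⟨ε, Cp, hε, hε1, hCp, H⟩ := pair hn s γ CΦ cb R (del' R δ) hs.1 hCΦ hcb hR hd'
  obtain ⟨C1, hC1, H1⟩ := chain n s γ ε hs.1 hε
  refine ⟨(C1 * (4 * Cp))⁻¹, by positivity, ?_⟩
  intro b hb g hg hg0 hG Cg hCg hL f hf
  have key := assemble hn s γ CΦ cb R δ ε Cp hCΦ hR hδ hε1 hCp b hb f hf
    (fun a c ha hc => H b hb a c ha hc f hf) g hg hg0 hG Cg hCg hL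
  set X := (∫⁻ x in Metric.closedBall (0 : V n) R, ENNReal.ofReal (g x)) * Ng CΦ γ b g f
  calc ENNReal.ofReal ((C1 * (4 * Cp))⁻¹ * Cg ^ 2) * NdotSq s γ f
      ≤ ENNReal.ofReal ((C1 * (4 * Cp))⁻¹ * Cg ^ 2) *
        (ENNReal.ofReal C1 * ∫⁻ v, ∫⁻ w, Sk s γ ε f v w) := mul_le_mul_right (H1 f hf) _
    _ = ENNReal.ofReal ((C1 * (4 * Cp))⁻¹ * C1) *
        (ENNReal.ofReal (Cg ^ 2) * ∫⁻ v, ∫⁻ w, Sk s γ ε f v w) := by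
        rw [ENNReal.ofReal_mul (by positivity), ENNReal.ofReal_mul (by positivity)]; ring
    _ ≤ ENNReal.ofReal ((C1 * (4 * Cp))⁻¹ * C1) * (ENNReal.ofReal (4 * Cp) * X) :=
        mul_le_mul_right key _
    _ = X := by
        rw [← mul_assoc, ← ENNReal.ofReal_mul (by positivity),
          show (C1 * (4 * Cp))⁻¹ * C1 * (4 * Cp) = 1 by field_simp, ENNReal.ofReal_one, one_mul]
end

/-- **Main coercive inequality** (Theorem 1, first part):
`(∫_{B_R} g) · N_g(f) ≥ C · C̃_g² · |f|²_{Ṅ^{s,γ}}`. -/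
theorem main_coercive_inequality
    (n : ℕ) (hn : 2 ≤ n) (s γ CΦ cb R δ : ℝ)
    (hs : s ∈ Set.Ioo (0:ℝ) 1) (hγ : -(n:ℝ) < γ) (hCΦ : 0 < CΦ) (hcb : 0 < cb)
    (hδ : 0 < δ) (hδR : δ < R) :
    ∃ C : ℝ, 0 < C ∧
      ∀ b : ℝ → ℝ, KernelAssumptions n s cb b →
      ∀ g : V n → ℝ, Measurable g → (∀ v, 0 ≤ g v) →
        (∫⁻ x in Metric.closedBall (0 : V n) R, ENNReal.ofReal (g x)) < ⊤ →
      ∀ Cg : ℝ, 0 < Cg → AssumptionL R δ Cg g →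
      ∀ f : V n → ℝ, Measurable f →
        ENNReal.ofReal (C * Cg ^ 2) * NdotSq s γ f ≤
          (∫⁻ x in Metric.closedBall (0 : V n) R, ENNReal.ofReal (g x)) *
            Ng CΦ γ b g f := by
  exact main_coercive_inequality_aux n hn s γ CΦ cb R δ hs hγ hCΦ hcb hδ hδR
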